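/- Let n ≥ 4 and let G be a connected simple graph on n vertices having a Laplacian eigenvalue of multiplicity n − 3. If H is any simple graph on n vertices whose Laplacian spectrum (as a multiset, with multiplicities) equals that of G, then H is isomorphic to G. In other words, every graph in 𝒢(n, n−3) is determined by its Laplacian spectrum. -/

import Mathlib

open Matrix in
/-- The rank of `A - α • 1` plus the algebraic multiplicity of `α` is the size of `A`. -/
lemma Matrix.IsHermitian.rank_sub_smul_one_add_rootMultiplicity {V : Type*} [Fintype V]
    [DecidableEq V] {A : Matrix V V ℝ} (hA : A.IsHermitian) (α : ℝ) :
    (A - α • (1 : Matrix V V ℝ)).rank + A.charpoly.rootMultiplicity α = Fintype.card V := by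
  have h1 : (A - α • (1 : Matrix V V ℝ)) =
      (hA.eigenvectorUnitary : Matrix V V ℝ) * diagonal (fun i => hA.eigenvalues i - α) *
        star (hA.eigenvectorUnitary : Matrix V V ℝ) := by
    have h2 : diagonal (fun i => hA.eigenvalues i - α) =
        diagonal hA.eigenvalues - α • (1 : Matrix V V ℝ) := by
      ext i j
      by_cases hij : i = j <;> simp [diagonal, hij]
    have h3 := hA.spectral_theorem
    rw [Unitary.conjStarAlgAut_apply] at h3
    have h4 : (hA.eigenvectorUnitary : Matrix V V ℝ) *
        star (hA.eigenvectorUnitary : Matrix V V ℝ) = 1 := Unitary.mul_star_self_of_mem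
          hA.eigenvectorUnitary.2
    rw [h2, Matrix.mul_sub, Matrix.sub_mul]
    conv_lhs => rw [h3]
    congr 1
    simp [h4]
  have h5 : IsUnit (hA.eigenvectorUnitary : Matrix V V ℝ).det :=
    (Matrix.isUnit_iff_isUnit_det _).1 (Unitary.toUnits hA.eigenvectorUnitary).isUnit
  have h6 : IsUnit (star (hA.eigenvectorUnitary : Matrix V V ℝ)).det :=
    (Matrix.isUnit_iff_isUnit_det _).1 (Unitary.toUnits (star hA.eigenvectorUnitary)).isUnit
  rw [h1, rank_mul_eq_left_of_isUnit_det _ _ h6, rank_mul_eq_right_of_isUnit_det _ _ h5,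
    rank_diagonal, ← Polynomial.count_roots, hA.roots_charpoly_eq_eigenvalues, Multiset.count_map]
  rw [Fintype.card_subtype]
  have h7 : (Multiset.filter (fun a => α = (RCLike.ofReal ∘ hA.eigenvalues) a)
      (Finset.univ : Finset V).val).card =
      (Finset.univ.filter (fun i => ¬ (hA.eigenvalues i - α ≠ 0))).card := by
    rw [← Finset.filter_val, Finset.card_val]
    congr 1
    ext i
    simp only [Function.comp_apply, RCLike.ofReal_real_eq_id, id_eq, Finset.mem_filter,
      Finset.mem_univ, true_and, ne_eq, not_not, sub_eq_zero]
    exact eq_comm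
  rw [h7, Finset.card_filter_add_card_filter_not]
  rfl

open Matrix in
lemma Matrix.IsHermitian.trace_pow_eq_of_roots_charpoly_eq {V : Type*} [Fintype V]
    [DecidableEq V] {A B : Matrix V V ℝ} (hA : A.IsHermitian) (hB : B.IsHermitian)
    (h : A.charpoly.roots = B.charpoly.roots) (k : ℕ) : (A ^ k).trace = (B ^ k).trace := by
  have key : ∀ {C : Matrix V V ℝ} (hC : C.IsHermitian),
      (C ^ k).trace = ((diagonal hC.eigenvalues) ^ k).trace := by
    intro C hC
    conv_lhs => rw [hC.spectral_theorem, ← map_pow, Unitary.conjStarAlgAut_apply]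
    rw [Matrix.trace_mul_comm, ← mul_assoc, Unitary.star_mul_self_of_mem hC.eigenvectorUnitary.2,
      one_mul]
    rfl
  have hc : A.charpoly = B.charpoly := by
    rw [hA.splits_charpoly.eq_prod_roots_of_monic A.charpoly_monic,
      hB.splits_charpoly.eq_prod_roots_of_monic B.charpoly_monic, h]
  rw [key hA, key hB, (IsHermitian.eigenvalues_eq_eigenvalues_iff hA hB).2 hc]

open Matrix in
lemma Matrix.rank_add_le' {V : Type*} [Fintype V] (A B : Matrix V V ℝ) :
    (A + B).rank ≤ A.rank + B.rank := by
  rw [Matrix.rank, Matrix.rank, Matrix.rank, Matrix.mulVecLin_add]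
  calc _ ≤ _ := Submodule.finrank_mono (LinearMap.range_add_le _ _)
    _ ≤ _ := Submodule.finrank_add_le_finrank_add_finrank _ _

open Matrix in
lemma Matrix.det_submatrix_fin_three_eq_zero {V : Type*} [Fintype V]
    {M : Matrix V V ℝ} (hM : M.rank ≤ 2) (x y : Fin 3 → V) : (M.submatrix x y).det = 0 := by
  by_contra h
  have h1 : (M.submatrix x y).rank = 3 := by
    rw [rank_of_isUnit _ ((Matrix.isUnit_iff_isUnit_det _).2 (isUnit_iff_ne_zero.2 h))]
    simp
  have := rank_submatrix_le M x y
  omega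

namespace SimpleGraph

variable {V : Type*} [Fintype V] [DecidableEq V]

/-- The Laplacian shifted by `α` on the orthogonal complement of the constant vectors, and killing
the constant vectors. -/
noncomputable def shiftedLap (G : SimpleGraph V) [DecidableRel G.Adj] (α : ℝ) : Matrix V V ℝ :=
  G.lapMatrix ℝ - α • (1 : Matrix V V ℝ) +
    Matrix.vecMulVec (fun _ => α / Fintype.card V) (fun _ => 1)

variable (G : SimpleGraph V) [DecidableRel G.Adj] (α : ℝ)

lemma shiftedLap_self (u : V) :
    G.shiftedLap α u u = G.degree u - α + α / Fintype.card V := by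
  simp [shiftedLap, lapMatrix, degMatrix, Matrix.vecMulVec_apply]

lemma shiftedLap_of_ne {u w : V} (h : u ≠ w) :
    G.shiftedLap α u w = α / Fintype.card V - if G.Adj u w then 1 else 0 := by
  simp only [shiftedLap, lapMatrix, degMatrix, Matrix.vecMulVec_apply, Matrix.add_apply,
    Matrix.sub_apply, Matrix.smul_apply, Matrix.one_apply_ne h, Matrix.diagonal_apply_ne _ h,
    adjMatrix_apply]
  simp only [smul_zero]
  ring

lemma shiftedLap_comm (u w : V) : G.shiftedLap α u w = G.shiftedLap α w u := by
  by_cases h : u = w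
  · rw [h]
  · simp only [shiftedLap_of_ne _ _ h, shiftedLap_of_ne _ _ (Ne.symm h), G.adj_comm u w]

lemma sum_shiftedLap (u : V) : ∑ w, G.shiftedLap α u w = 0 := by
  have : Nonempty V := ⟨u⟩
  have h1 := congrFun (G.lapMatrix_mulVec_const_eq_zero (R := ℝ)) u
  simp only [Matrix.mulVec, dotProduct, mul_one, Pi.zero_apply] at h1
  simp only [shiftedLap, Matrix.add_apply, Matrix.sub_apply, Matrix.smul_apply,
    Matrix.vecMulVec_apply, Finset.sum_add_distrib, Finset.sum_sub_distrib, h1]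
  simp [Matrix.one_apply]
  field_simp
  ring

lemma rank_shiftedLap [Nonempty V] (hα : α ≠ 0)
    (h : (G.lapMatrix ℝ - α • (1 : Matrix V V ℝ)).rank = 3) : (G.shiftedLap α).rank = 2 := by
  apply le_antisymm
  · set N := G.lapMatrix ℝ - α • (1 : Matrix V V ℝ) with hN
    have hk : LinearMap.ker N.mulVecLin ⊔ Submodule.span ℝ {(fun _ => 1 : V → ℝ)} ≤
        LinearMap.ker (G.shiftedLap α).mulVecLin := by
      refine sup_le ?_ ?_
      · intro x hx
        rw [LinearMap.mem_ker, Matrix.mulVecLin_apply] at hx ⊢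
        have hs : ∑ w, x w = 0 := by
          have h1 : (fun _ => (1 : ℝ)) ⬝ᵥ (N.mulVec x) = 0 := by rw [hx]; simp
          rw [Matrix.dotProduct_mulVec, hN, Matrix.vecMul_sub, ← Matrix.mulVec_transpose,
            (G.isSymm_lapMatrix (R := ℝ)).eq, G.lapMatrix_mulVec_const_eq_zero,
            Matrix.vecMul_smul, Matrix.vecMul_one] at h1
          simp only [dotProduct, zero_sub, Pi.neg_apply, Pi.smul_apply, smul_eq_mul, mul_one,
            neg_mul, Finset.sum_neg_distrib, ← Finset.mul_sum] at h1
          simpa [hα] using h1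
        rw [shiftedLap, Matrix.add_mulVec, ← hN, hx, zero_add]
        ext u
        simp [Matrix.mulVec, dotProduct, Matrix.vecMulVec_apply, ← Finset.mul_sum, hs]
      · rw [Submodule.span_singleton_le_iff_mem, LinearMap.mem_ker, Matrix.mulVecLin_apply]
        ext u
        simpa [Matrix.mulVec, dotProduct] using G.sum_shiftedLap α u
    have hd : LinearMap.ker N.mulVecLin ⊓ Submodule.span ℝ {(fun _ => 1 : V → ℝ)} = ⊥ := by
      rw [eq_bot_iff]
      rintro x ⟨hx1, hx2⟩
      obtain ⟨t, rfl⟩ := Submodule.mem_span_singleton.1 hx2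
      have hx3 : N.mulVec (t • (fun _ => 1 : V → ℝ)) = 0 := hx1
      rw [hN, Matrix.mulVec_smul, Matrix.sub_mulVec, G.lapMatrix_mulVec_const_eq_zero,
        Matrix.smul_mulVec, Matrix.one_mulVec] at hx3
      have := congrFun hx3 (Classical.arbitrary V)
      simp [hα] at this
      simp [this]
    have e1 := Submodule.finrank_sup_add_finrank_inf_eq (LinearMap.ker N.mulVecLin)
      (Submodule.span ℝ {(fun _ => 1 : V → ℝ)})
    rw [hd, finrank_bot, finrank_span_singleton (by
      intro h; simpa using congrFun h (Classical.arbitrary V))] at e1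
    have e2 := Submodule.finrank_mono hk
    have e3 := LinearMap.finrank_range_add_finrank_ker N.mulVecLin
    have e4 := LinearMap.finrank_range_add_finrank_ker (G.shiftedLap α).mulVecLin
    change N.rank + _ = _ at e3
    change (G.shiftedLap α).rank + _ = _ at e4
    omega
  · have h1 : G.lapMatrix ℝ - α • (1 : Matrix V V ℝ) = G.shiftedLap α +
        Matrix.vecMulVec (fun _ => -(α / Fintype.card V)) (fun _ => 1) := by
      ext u w
      simp [shiftedLap, Matrix.vecMulVec_apply]
    have h2 := Matrix.rank_add_le' (G.shiftedLap α)
        (Matrix.vecMulVec (fun _ => -(α / Fintype.card V)) (fun _ => 1))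
    have h3 := Matrix.rank_vecMulVec_le (R := ℝ) (fun _ : V => -(α / Fintype.card V : ℝ))
      (fun _ : V => 1)
    rw [← h1] at h2
    omega

lemma shiftedLap_compl [Nonempty V] :
    Gᶜ.shiftedLap (Fintype.card V - α) = - G.shiftedLap α := by
  ext u w
  rw [Matrix.neg_apply]
  by_cases h : u = w
  · subst h
    rw [shiftedLap_self, shiftedLap_self, degree_compl, Nat.sub_sub,
      Nat.cast_sub (by have := G.degree_lt_card_verts u; omega)]
    push_cast
    field_simp
    ring
  · rw [shiftedLap_of_ne _ _ h, shiftedLap_of_ne _ _ h]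
    by_cases h' : G.Adj u w
    · simp [h, h']
      field_simp
    · simp [h, h']
      field_simp
      ring

end SimpleGraph

namespace SimpleGraph

variable {V : Type*} [Fintype V] [DecidableEq V] (G : SimpleGraph V) [DecidableRel G.Adj]

lemma nonneg_of_lapMatrix_mulVec_eq {α : ℝ} {x : V → ℝ} (hx : x ≠ 0)
    (h : (G.lapMatrix ℝ).mulVec x = α • x) : 0 ≤ α := by
  have h1 := (G.posSemidef_lapMatrix (R := ℝ)).dotProduct_mulVec_nonneg x
  rw [h, dotProduct_smul] at h1
  have h2 : 0 < star x ⬝ᵥ x := by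
    simpa using Matrix.dotProduct_star_self_pos_iff.2 hx
  exact nonneg_of_mul_nonneg_left h1 h2

lemma sum_eq_zero_of_lapMatrix_mulVec_eq {α : ℝ} (hα : α ≠ 0) {x : V → ℝ}
    (h : (G.lapMatrix ℝ).mulVec x = α • x) : ∑ w, x w = 0 := by
  have h1 : (fun _ => (1 : ℝ)) ⬝ᵥ ((G.lapMatrix ℝ).mulVec x) = α * ∑ w, x w := by
    rw [h]; simp [dotProduct, Finset.mul_sum]
  rw [Matrix.dotProduct_mulVec, ← Matrix.mulVec_transpose, (G.isSymm_lapMatrix (R := ℝ)).eq,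
    G.lapMatrix_mulVec_const_eq_zero, zero_dotProduct] at h1
  simpa [hα] using h1.symm

lemma le_card_of_lapMatrix_mulVec_eq [Nonempty V] {α : ℝ} {x : V → ℝ} (hx : x ≠ 0)
    (h : (G.lapMatrix ℝ).mulVec x = α • x) : α ≤ Fintype.card V := by
  rcases eq_or_ne α 0 with rfl | hα
  · positivity
  have hs := G.sum_eq_zero_of_lapMatrix_mulVec_eq hα h
  have hJ : ∀ t : ℝ, (Matrix.vecMulVec (fun _ : V => t) (fun _ : V => 1)).mulVec x = 0 := by
    intro t
    ext u
    simp [Matrix.mulVec, dotProduct, Matrix.vecMulVec_apply, ← Finset.mul_sum, hs]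
  have h1 := congrArg (fun M => M.mulVec x) (G.shiftedLap_compl α)
  simp only [shiftedLap, Matrix.neg_mulVec, Matrix.add_mulVec, Matrix.sub_mulVec, hJ, h,
    Matrix.smul_mulVec, Matrix.one_mulVec, sub_self, add_zero, neg_zero, sub_eq_zero] at h1
  have := nonneg_of_lapMatrix_mulVec_eq Gᶜ hx h1
  linarith

lemma pos_and_le_card_of_rank_eq_three (hG : G.Connected) (hV : 5 ≤ Fintype.card V) {α : ℝ}
    (h : (G.lapMatrix ℝ - α • (1 : Matrix V V ℝ)).rank = 3) :
    0 < α ∧ α ≤ Fintype.card V := by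
  have := hG.nonempty
  have h1 := LinearMap.finrank_range_add_finrank_ker
    (G.lapMatrix ℝ - α • (1 : Matrix V V ℝ)).mulVecLin
  change Matrix.rank _ + _ = _ at h1
  rw [h, Module.finrank_fintype_fun_eq_card] at h1
  have h2 : LinearMap.ker (G.lapMatrix ℝ - α • (1 : Matrix V V ℝ)).mulVecLin ≠ ⊥ := by
    intro h3
    rw [h3, finrank_bot] at h1
    omega
  obtain ⟨x, hx, hx0⟩ := Submodule.exists_mem_ne_zero_of_ne_bot h2
  rw [LinearMap.mem_ker, Matrix.mulVecLin_apply, Matrix.sub_mulVec, Matrix.smul_mulVec,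
    Matrix.one_mulVec, sub_eq_zero] at hx
  refine ⟨lt_of_le_of_ne (G.nonneg_of_lapMatrix_mulVec_eq hx0 hx) ?_,
    G.le_card_of_lapMatrix_mulVec_eq hx0 hx⟩
  rintro rfl
  have := hG.preconnected.subsingleton_connectedComponent
  have h5 := card_connectedComponent_eq_finrank_ker_toLin'_lapMatrix G
  rw [← Nat.card_eq_fintype_card, Nat.card_of_subsingleton (G.connectedComponentMk
    (Classical.arbitrary V)), Matrix.toLin'_apply'] at h5
  rw [zero_smul, sub_zero, ← h5] at h1
  omega

end SimpleGraph

namespace SimpleGraph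

section Blowup

/-- `G` is obtained from the looped graph `R` by replacing each vertex `i` by `size i` twins,
forming a clique if `R i i` and a coclique otherwise. -/
def IsBlowup {V ι : Type*} [Fintype V] [DecidableEq ι] (G : SimpleGraph V) (R : ι → ι → Bool)
    (size : ι → ℕ) : Prop :=
  ∃ f : V → ι, (∀ u w, u ≠ w → (G.Adj u w ↔ R (f u) (f w) = true)) ∧
    ∀ i, (Finset.univ.filter (fun u => f u = i)).card = size i

variable {V W ι κ : Type*} [Fintype V] [Fintype W] [DecidableEq ι] [DecidableEq κ]
  {G : SimpleGraph V} {H : SimpleGraph W}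

lemma IsBlowup.compl {R : ι → ι → Bool} {size : ι → ℕ} (h : G.IsBlowup R size) :
    Gᶜ.IsBlowup (fun i j => !R i j) size := by
  obtain ⟨f, h1, h2⟩ := h
  refine ⟨f, fun u w huw => ?_, h2⟩
  rw [compl_adj, h1 u w huw]
  simp [huw]

/-- Blow-ups of isomorphic looped graphs with the same sizes are isomorphic. -/
lemma IsBlowup.nonempty_iso {R : ι → ι → Bool} {S : κ → κ → Bool} {size : ι → ℕ}
    {size' : κ → ℕ} (hG : G.IsBlowup R size) (hH : H.IsBlowup S size') (π : ι ≃ κ)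
    (hsize : ∀ i, size i = size' (π i))
    (hRS : ∀ i j, size i ≠ 0 → size j ≠ 0 → R i j = S (π i) (π j)) : Nonempty (G ≃g H) := by
  obtain ⟨f, f1, f2⟩ := hG
  obtain ⟨g, g1, g2⟩ := hH
  have key : ∀ i, Nonempty ({u // f u = i} ≃ {w // π.symm (g w) = i}) := by
    intro i
    refine ⟨Fintype.equivOfCardEq ?_⟩
    rw [Fintype.card_subtype, Fintype.card_subtype, f2, hsize, ← g2]
    congr 1
    ext w
    simp [Equiv.symm_apply_eq]
  let e : V ≃ W := (Equiv.sigmaFiberEquiv f).symm.trans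
    ((Equiv.sigmaCongrRight fun i => (key i).some).trans
      (Equiv.sigmaFiberEquiv fun w => π.symm (g w)))
  have he : ∀ u, g (e u) = π (f u) := by
    intro u
    rw [← Equiv.symm_apply_eq]
    exact ((key (f u)).some ⟨u, rfl⟩).2
  have hne : ∀ u, size (f u) ≠ 0 := by
    intro u
    rw [← f2, Finset.card_ne_zero]
    exact ⟨u, by simp⟩
  refine ⟨⟨e, ?_⟩⟩
  intro u w
  by_cases huw : u = w
  · simp [huw]
  · rw [g1 _ _ (by simpa using huw), f1 _ _ huw, he, he, hRS _ _ (hne u) (hne w)]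

lemma isBlowup_of_partition {R : ι → ι → Bool} (S : ι → Finset V)
    (hcover : ∀ x, ∃ i, x ∈ S i) (hdisj : ∀ i j x, x ∈ S i → x ∈ S j → i = j)
    (hadj : ∀ i j, ∀ u ∈ S i, ∀ w ∈ S j, u ≠ w → (G.Adj u w ↔ R i j = true)) :
    G.IsBlowup R (fun i => (S i).card) := by
  choose f hf using hcover
  refine ⟨f, fun u w huw => hadj _ _ u (hf u) w (hf w) huw, fun i => ?_⟩
  congr 1
  ext x
  simp only [Finset.mem_filter, Finset.mem_univ, true_and]
  exact ⟨fun h => h ▸ hf x, fun h => hdisj _ _ x (hf x) h⟩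

/-- The symmetric looped graph on four vertices with the given upper triangle. -/
def looped (r00 r01 r02 r03 r11 r12 r13 r22 r23 r33 : Bool) : Fin 4 → Fin 4 → Bool :=
  ![![r00, r01, r02, r03], ![r01, r11, r12, r13], ![r02, r12, r22, r23], ![r03, r13, r23, r33]]

lemma isBlowup_looped {r00 r01 r02 r03 r11 r12 r13 r22 r23 r33 : Bool} (S0 S1 S2 S3 : Finset V)
    (hcover : ∀ x, x ∈ S0 ∨ x ∈ S1 ∨ x ∈ S2 ∨ x ∈ S3)
    (d01 : ∀ x ∈ S0, x ∉ S1) (d02 : ∀ x ∈ S0, x ∉ S2) (d03 : ∀ x ∈ S0, x ∉ S3)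
    (d12 : ∀ x ∈ S1, x ∉ S2) (d13 : ∀ x ∈ S1, x ∉ S3) (d23 : ∀ x ∈ S2, x ∉ S3)
    (h00 : ∀ u ∈ S0, ∀ w ∈ S0, u ≠ w → (G.Adj u w ↔ r00 = true))
    (h01 : ∀ u ∈ S0, ∀ w ∈ S1, u ≠ w → (G.Adj u w ↔ r01 = true))
    (h02 : ∀ u ∈ S0, ∀ w ∈ S2, u ≠ w → (G.Adj u w ↔ r02 = true))
    (h03 : ∀ u ∈ S0, ∀ w ∈ S3, u ≠ w → (G.Adj u w ↔ r03 = true))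
    (h11 : ∀ u ∈ S1, ∀ w ∈ S1, u ≠ w → (G.Adj u w ↔ r11 = true))
    (h12 : ∀ u ∈ S1, ∀ w ∈ S2, u ≠ w → (G.Adj u w ↔ r12 = true))
    (h13 : ∀ u ∈ S1, ∀ w ∈ S3, u ≠ w → (G.Adj u w ↔ r13 = true))
    (h22 : ∀ u ∈ S2, ∀ w ∈ S2, u ≠ w → (G.Adj u w ↔ r22 = true))
    (h23 : ∀ u ∈ S2, ∀ w ∈ S3, u ≠ w → (G.Adj u w ↔ r23 = true))
    (h33 : ∀ u ∈ S3, ∀ w ∈ S3, u ≠ w → (G.Adj u w ↔ r33 = true)) :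
    G.IsBlowup (looped r00 r01 r02 r03 r11 r12 r13 r22 r23 r33)
      ![S0.card, S1.card, S2.card, S3.card] := by
  have flip : ∀ {A B : Finset V} {r : Bool},
      (∀ u ∈ A, ∀ w ∈ B, u ≠ w → (G.Adj u w ↔ r = true)) →
      ∀ u ∈ B, ∀ w ∈ A, u ≠ w → (G.Adj u w ↔ r = true) := by
    intro A B r h u hu w hw huw
    rw [G.adj_comm, h w hw u hu huw.symm]
  have h := isBlowup_of_partition (G := G)
    (R := looped r00 r01 r02 r03 r11 r12 r13 r22 r23 r33) ![S0, S1, S2, S3] ?_ ?_ ?_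
  · convert h using 1
    ext i
    fin_cases i <;> rfl
  · intro x
    rcases hcover x with h | h | h | h
    exacts [⟨0, h⟩, ⟨1, h⟩, ⟨2, h⟩, ⟨3, h⟩]
  · intro i j x hi hj
    fin_cases i <;> fin_cases j <;> first
      | rfl
      | exact absurd hj (d01 x hi) | exact absurd hj (d02 x hi) | exact absurd hj (d03 x hi)
      | exact absurd hj (d12 x hi) | exact absurd hj (d13 x hi) | exact absurd hj (d23 x hi)
      | exact absurd hi (d01 x hj) | exact absurd hi (d02 x hj) | exact absurd hi (d03 x hj)
      | exact absurd hi (d12 x hj) | exact absurd hi (d13 x hj) | exact absurd hi (d23 x hj)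
  · intro i j
    fin_cases i <;> fin_cases j
    exacts [h00, h01, h02, h03, flip h01, h11, h12, h13, flip h02, flip h12, h22, h23,
      flip h03, flip h13, flip h23, h33]

lemma isBlowup_looped_three {r00 r01 r02 r11 r12 r22 : Bool} {S0 S1 S2 : Finset V} {n0 n1 n2 : ℕ}
    (c0 : S0.card = n0) (c1 : S1.card = n1) (c2 : S2.card = n2)
    (hcover : ∀ x, x ∈ S0 ∨ x ∈ S1 ∨ x ∈ S2)
    (d01 : ∀ x ∈ S0, x ∉ S1) (d02 : ∀ x ∈ S0, x ∉ S2) (d12 : ∀ x ∈ S1, x ∉ S2)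
    (h00 : ∀ u ∈ S0, ∀ w ∈ S0, u ≠ w → (G.Adj u w ↔ r00 = true))
    (h01 : ∀ u ∈ S0, ∀ w ∈ S1, u ≠ w → (G.Adj u w ↔ r01 = true))
    (h02 : ∀ u ∈ S0, ∀ w ∈ S2, u ≠ w → (G.Adj u w ↔ r02 = true))
    (h11 : ∀ u ∈ S1, ∀ w ∈ S1, u ≠ w → (G.Adj u w ↔ r11 = true))
    (h12 : ∀ u ∈ S1, ∀ w ∈ S2, u ≠ w → (G.Adj u w ↔ r12 = true))
    (h22 : ∀ u ∈ S2, ∀ w ∈ S2, u ≠ w → (G.Adj u w ↔ r22 = true)) :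
    G.IsBlowup (looped r00 r01 r02 false r11 r12 false r22 false false) ![n0, n1, n2, 0] := by
  subst c0 c1 c2
  refine isBlowup_looped S0 S1 S2 ∅ (fun x => ?_) d01 d02 ?_ d12 ?_ ?_ h00 h01 h02 ?_ h11 h12 ?_
    h22 ?_ ?_
  · rcases hcover x with h | h | h <;> simp [h]
  all_goals simp

end Blowup

/-- The looped graphs and sizes of the graphs on `n` vertices which have twins of degree `a`, with
`a` as a Laplacian eigenvalue of multiplicity `n - 3`; `σ` is the sum of `deg u - a` over the
vertices `u`. -/
inductive TwinType (n a : ℕ) (σ : ℤ) : (Fin 4 → Fin 4 → Bool) → (Fin 4 → ℕ) → Prop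
  | joinEdge (p : ℕ) (hn : n = p + 2 + a) (ha : 1 ≤ a) (h : a = 1 ∨ n = 2 * a)
      (hσ : σ = n - 2 * a + 2) :
      TwinType n a σ
        (looped false false true false true true false false false false) ![p, 2, a, 0]
  | unionBipartite (j p : ℕ) (hn : n = j + p + a) (ha : 1 ≤ a) (hp : 2 ≤ p)
      (h : (j = a ∧ p = a) ∨ (j = 1 ∧ (p = a ∨ a = 1))) (hσ : σ = p - 2 * a) :
      TwinType n a σ
        (looped true false false false false true false false false false) ![j, p, a, 0]
  | doublePath (p q : ℕ) (hn : n = 2 * a) (ha : a = p + q) (hp : 2 ≤ p) (hq : 1 ≤ q)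
      (hσ : σ = -2 * q) :
      TwinType n a σ
        (looped false true true false false false true true false true) ![p, p, q, q]
  | joinPair (p : ℕ) (b : Bool) (hn : n = p + 2) (ha : a = 2)
      (hσ : σ = 2 * n - if b then 6 else 8) :
      TwinType n a σ
        (looped false true false false b false false false false false) ![p, 2, 0, 0]
  | tripartite (i j : ℕ) (hn : n = 2 * i + j) (ha : a = i + j) (hi : 2 ≤ i)
      (h : j = 1 ∨ j = i) (hσ : σ = i - j) :
      TwinType n a σ
        (looped false true true false false true false false false false) ![i, i, j, 0]
  | joinCliques (i : ℕ) (hn : n = 3 * i) (ha : a = 2 * i) (hi : 2 ≤ i) (hσ : σ = -2 * i) :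
      TwinType n a σ
        (looped false true true false true false false true false false) ![i, i, i, 0]

section Iso

variable {V W : Type*} [Fintype V] [Fintype W] {G : SimpleGraph V} {H : SimpleGraph W}
  {R S : Fin 4 → Fin 4 → Bool} {s t : Fin 4 → ℕ} {n a : ℕ} {σ : ℤ}

lemma TwinType.nonempty_iso (hn : 6 ≤ n) (hR : TwinType n a σ R s) (hS : TwinType n a σ S t)
    (hG : G.IsBlowup R s) (hH : H.IsBlowup S t) : Nonempty (G ≃g H) := by
  have h : R = S ∧ s = t := by
    cases hR with
    | joinEdge p => cases hS with
      | joinEdge p' => obtain rfl : p = p' := by omega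
                       exact ⟨rfl, rfl⟩
      | joinPair p' b => cases b <;> simp at * <;> omega
      | _ => omega
    | unionBipartite j p => cases hS with
      | unionBipartite j' p' => obtain ⟨rfl, rfl⟩ : j = j' ∧ p = p' := by omega
                                exact ⟨rfl, rfl⟩
      | joinPair p' b => cases b <;> simp at * <;> omega
      | _ => omega
    | doublePath p q => cases hS with
      | doublePath p' q' => obtain ⟨rfl, rfl⟩ : p = p' ∧ q = q' := by omega
                            exact ⟨rfl, rfl⟩
      | joinPair p' b => cases b <;> simp at * <;> omega
      | _ => omega
    | joinPair p b => cases hS with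
      | joinPair p' b' =>
        obtain rfl : p = p' := by omega
        cases b <;> cases b' <;> first | exact ⟨rfl, rfl⟩ | (simp at *; omega)
      | _ => cases b <;> simp at * <;> omega
    | tripartite i j => cases hS with
      | tripartite i' j' => obtain ⟨rfl, rfl⟩ : i = i' ∧ j = j' := by omega
                            exact ⟨rfl, rfl⟩
      | joinPair p' b => cases b <;> simp at * <;> omega
      | _ => omega
    | joinCliques i => cases hS with
      | joinCliques i' => obtain rfl : i = i' := by omega
                          exact ⟨rfl, rfl⟩
      | joinPair p' b => cases b <;> simp at * <;> omega
      | _ => omega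
  obtain ⟨rfl, rfl⟩ := h
  exact hG.nonempty_iso hH (Equiv.refl _) (fun _ => rfl) (fun _ _ _ _ => rfl)

/-- A graph with twins and the complement of a graph with twins, with matching parameters, are
isomorphic. -/
lemma TwinType.nonempty_iso_of_compl (hn : 6 ≤ n) (ha : a < n) (hR : TwinType n a σ R s)
    (hS : TwinType n (n - a) (-n - σ) S t) (hG : G.IsBlowup R s) (hH : Hᶜ.IsBlowup S t) :
    Nonempty (G ≃g H) := by
  have hH' := hH.compl
  rw [compl_compl] at hH'
  obtain ⟨b, hb⟩ : ∃ b, b = n - a := ⟨_, rfl⟩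
  rw [← hb] at hS
  cases hR with
  | joinEdge p => cases hS with
    | joinPair p' b => cases b <;> simp at * <;> omega
    | _ => omega
  | unionBipartite j p => cases hS with
    | joinPair p' b => cases b <;> simp at * <;> omega
    | joinCliques i =>
      obtain ⟨rfl, rfl, rfl⟩ : j = i ∧ p = i ∧ a = i := by omega
      refine hG.nonempty_iso hH' (Equiv.refl _) (fun _ => rfl) fun k l hk hl => ?_
      fin_cases k <;> fin_cases l <;> first | rfl | exact absurd rfl hk | exact absurd rfl hl
    | _ => omega
  | doublePath p q => cases hS with
    | joinPair p' b => cases b <;> simp at * <;> omega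
    | doublePath p' q' =>
      obtain ⟨rfl, rfl⟩ : p' = q ∧ q' = p := by omega
      refine hG.nonempty_iso hH' ⟨![2, 3, 1, 0], ![3, 2, 0, 1], by decide, by decide⟩
        (fun k => ?_) fun k l _ _ => ?_
      · fin_cases k <;> rfl
      · fin_cases k <;> fin_cases l <;> rfl
    | _ => omega
  | joinPair p b => cases hS with
    | joinPair p' b' => cases b <;> cases b' <;> simp at * <;> omega
    | _ => cases b <;> simp at * <;> omega
  | tripartite i j => cases hS with
    | joinPair p' b => cases b <;> simp at * <;> omega
    | _ => omega
  | joinCliques i => cases hS with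
    | joinPair p' b => cases b <;> simp at * <;> omega
    | unionBipartite j p =>
      obtain ⟨rfl, rfl, rfl⟩ : j = i ∧ p = i ∧ b = i := by omega
      refine hG.nonempty_iso hH' (Equiv.refl _) (fun _ => rfl) fun k l hk hl => ?_
      fin_cases k <;> fin_cases l <;> first | rfl | exact absurd rfl hk | exact absurd rfl hl
    | _ => omega

end Iso

end SimpleGraph

namespace SimpleGraph

section TwinRep

variable {V : Type*} [Fintype V] [DecidableEq V]

/-- The shape of the shifted Laplacian of `G` when `G` has twins of degree `a` whose neighbourhood
is `Q`, after splitting off the rank one part coming from the twins: the remaining rank one part is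
`ε • y yᵀ`. -/
structure IsTwinRep (G : SimpleGraph V) (a : ℕ) (σ : ℤ) (ε s : ℝ) (Q : Finset V) (y : V → ℝ) :
    Prop where
  sign : ε = 1 ∨ ε = -1
  pos : 0 < s
  card_eq : Q.card = a
  card_compl_eq : (Qᶜ.card : ℝ) = s * a
  exists_ne_zero : ∃ x, y x ≠ 0
  sum_eq_zero : ∑ x, y x = 0
  exists_twins : ∃ x ∉ Q, ∃ z ∉ Q, x ≠ z ∧ y x = 0 ∧ y z = 0
  outer_adj : ∀ x ∉ Q, ∀ z ∉ Q, G.Adj x z → ε * (y x * y z) = -1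
  outer_not_adj : ∀ x ∉ Q, ∀ z ∉ Q, x ≠ z → ¬ G.Adj x z → y x * y z = 0
  mixed_adj : ∀ x ∉ Q, ∀ z ∈ Q, G.Adj x z → y x * y z = 0
  mixed_not_adj : ∀ x ∉ Q, ∀ z ∈ Q, ¬ G.Adj x z → ε * (y x * y z) = 1
  inner_adj : ∀ x ∈ Q, ∀ z ∈ Q, G.Adj x z → ε * (y x * y z) = -s
  inner_not_adj : ∀ x ∈ Q, ∀ z ∈ Q, x ≠ z → ¬ G.Adj x z → ε * (y x * y z) = 1 - s
  sum_degree : (σ : ℝ) = ε * ∑ x, y x ^ 2 + Fintype.card V - 2 * a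

lemma sum_eq_of_two_values {S T : Finset V} (hST : Disjoint S T) {f : V → ℝ} {v w : ℝ}
    (hS : ∀ x ∈ S, f x = v) (hT : ∀ x ∈ T, f x = w) (h0 : ∀ x, x ∉ S → x ∉ T → f x = 0) :
    ∑ x, f x = S.card * v + T.card * w := by
  rw [← Finset.sum_subset (Finset.subset_univ (S ∪ T)) (fun x _ hx => by
    rw [Finset.mem_union, not_or] at hx; exact h0 x hx.1 hx.2), Finset.sum_union hST,
    Finset.sum_congr rfl hS, Finset.sum_congr rfl hT]
  simp

namespace IsTwinRep

variable {G : SimpleGraph V} {a : ℕ} {σ : ℤ} {ε s : ℝ} {Q : Finset V} {y : V → ℝ}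

lemma neg (h : G.IsTwinRep a σ ε s Q y) : G.IsTwinRep a σ ε s Q (-y) where
  sign := h.sign
  pos := h.pos
  card_eq := h.card_eq
  card_compl_eq := h.card_compl_eq
  exists_ne_zero := by simpa using h.exists_ne_zero
  sum_eq_zero := by simpa using h.sum_eq_zero
  exists_twins := by simpa using h.exists_twins
  outer_adj := by simpa using h.outer_adj
  outer_not_adj := by simpa using h.outer_not_adj
  mixed_adj := by simpa using h.mixed_adj
  mixed_not_adj := by simpa using h.mixed_not_adj
  inner_adj := by simpa using h.inner_adj
  inner_not_adj := by simpa using h.inner_not_adj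
  sum_degree := by simpa using h.sum_degree

lemma ne_zero (h : G.IsTwinRep a σ ε s Q y) : ε ≠ 0 := by
  rcases h.sign with h | h <;> rw [h] <;> norm_num

lemma card_add (h : G.IsTwinRep a σ ε s Q y) : a + Qᶜ.card = Fintype.card V := by
  rw [← h.card_eq, Finset.card_add_card_compl]

lemma two_le_card_compl (h : G.IsTwinRep a σ ε s Q y) : 2 ≤ Qᶜ.card := by
  obtain ⟨x, hx, z, hz, hxz, -, -⟩ := h.exists_twins
  rw [← Finset.card_pair hxz]
  exact Finset.card_le_card (by
    intro w hw
    rcases Finset.mem_insert.1 hw with rfl | hw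
    · simpa using hx
    · rw [Finset.mem_singleton.1 hw]; simpa using hz)

lemma one_le (h : G.IsTwinRep a σ ε s Q y) : 1 ≤ a := by
  by_contra h0
  obtain rfl : a = 0 := by omega
  have h1 := h.card_compl_eq
  have h2 := h.two_le_card_compl
  rw [Nat.cast_zero, mul_zero, Nat.cast_eq_zero] at h1
  omega

lemma eq_two_mul (h : G.IsTwinRep a σ ε s Q y) (hs : s = 1) : Fintype.card V = 2 * a := by
  have h1 := h.card_compl_eq
  have h2 := h.card_add
  rw [hs, one_mul, Nat.cast_inj] at h1
  omega

lemma exists_neg (h : G.IsTwinRep a σ ε s Q y) {x : V} (hx : 0 < y x) : ∃ z, y z < 0 := by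
  by_contra! h0
  have := (Finset.sum_eq_zero_iff_of_nonneg (fun i _ => h0 i)).1 h.sum_eq_zero x (Finset.mem_univ x)
  linarith

lemma exists_pos (h : G.IsTwinRep a σ ε s Q y) : ∃ z, 0 < y z := by
  obtain ⟨x, hx⟩ := h.exists_ne_zero
  rcases lt_or_gt_of_ne hx with hx | hx
  · obtain ⟨z, hz⟩ := h.neg.exists_neg (x := x) (by simpa using hx)
    exact ⟨z, by simpa using hz⟩
  · exact ⟨x, hx⟩

lemma outer_adj_iff (h : G.IsTwinRep a σ ε s Q y) {x z : V} (hx : x ∉ Q) (hz : z ∉ Q)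
    (hxz : x ≠ z) : G.Adj x z ↔ y x * y z ≠ 0 := by
  refine ⟨fun h1 h2 => ?_, fun h1 => ?_⟩
  · have := h.outer_adj x hx z hz h1
    rw [h2] at this
    norm_num at this
  · by_contra h2
    exact h1 (h.outer_not_adj x hx z hz hxz h2)

lemma mixed_adj_iff (h : G.IsTwinRep a σ ε s Q y) {x z : V} (hx : x ∉ Q) (hz : z ∈ Q) :
    G.Adj x z ↔ y x * y z = 0 := by
  refine ⟨h.mixed_adj x hx z hz, fun h1 => ?_⟩
  by_contra h2
  have := h.mixed_not_adj x hx z hz h2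
  rw [h1] at this
  norm_num at this

lemma outer_mul (h : G.IsTwinRep a σ ε s Q y) {x z : V} (hx : x ∉ Q) (hz : z ∉ Q)
    (hxz : x ≠ z) (h0 : y x * y z ≠ 0) : ε * (y x * y z) = -1 :=
  h.outer_adj x hx z hz ((h.outer_adj_iff hx hz hxz).2 h0)

lemma mixed_mul (h : G.IsTwinRep a σ ε s Q y) {x z : V} (hx : x ∉ Q) (hz : z ∈ Q)
    (h0 : y x * y z ≠ 0) : ε * (y x * y z) = 1 :=
  h.mixed_not_adj x hx z hz (by rwa [h.mixed_adj_iff hx hz])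

/-- If `y z = 0` for some `z ∈ Q` then `z` is adjacent to no other vertex of `Q`. -/
lemma inner_of_eq_zero (h : G.IsTwinRep a σ ε s Q y) {x z : V} (hx : x ∈ Q) (hz : z ∈ Q)
    (hxz : x ≠ z) (h0 : y x * y z = 0) : ¬ G.Adj x z ∧ s = 1 := by
  by_cases h1 : G.Adj x z
  · have h2 := h.inner_adj x hx z hz h1
    rw [h0] at h2
    linarith [h.pos]
  · have h2 := h.inner_not_adj x hx z hz hxz h1
    rw [h0] at h2
    exact ⟨h1, by linarith⟩

/-- The conclusion of the classification. -/
def HasTwinType (G : SimpleGraph V) (a : ℕ) (σ : ℤ) : Prop :=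
  ∃ R size, TwinType (Fintype.card V) a σ R size ∧ G.IsBlowup R size

/-- If a vertex outside `Q` has positive value and all values in `Q` vanish. -/
lemma hasTwinType_of_inner_eq_zero (h : G.IsTwinRep a σ ε s Q y) (h0 : ∀ x ∈ Q, y x = 0) :
    HasTwinType G a σ := by
  obtain ⟨u, hu⟩ := h.exists_pos
  obtain ⟨w, hw⟩ := h.exists_neg hu
  have huw : u ≠ w := by rintro rfl; linarith
  have huQ : u ∉ Q := fun h1 => hu.ne' (h0 u h1)
  have hwQ : w ∉ Q := fun h1 => hw.ne (h0 w h1)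
  have e1 := h.outer_mul huQ hwQ huw (mul_ne_zero hu.ne' hw.ne)
  have hε : ε = 1 := by
    rcases h.sign with h1 | h1
    · exact h1
    · rw [h1] at e1
      nlinarith
  subst hε
  have hother : ∀ x, x ≠ u → x ≠ w → y x = 0 := by
    intro x hxu hxw
    by_contra hx
    have hxQ : x ∉ Q := fun h1 => hx (h0 x h1)
    have e2 := h.outer_mul hxQ huQ hxu (mul_ne_zero hx hu.ne')
    have e3 := h.outer_mul hxQ hwQ hxw (mul_ne_zero hx hw.ne)
    rcases lt_or_gt_of_ne hx with hx | hx
    · nlinarith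
    · nlinarith
  have hd : Disjoint ({u} : Finset V) {w} := by simpa using huw
  have s1 := sum_eq_of_two_values hd (f := y) (v := y u) (w := y w) (by simp) (by simp)
    (fun x hx hx' => hother x (by simpa using hx) (by simpa using hx'))
  have s2 := sum_eq_of_two_values hd (f := fun x => y x ^ 2) (v := y u ^ 2) (w := y w ^ 2)
    (by simp) (by simp)
    (fun x hx hx' => by simp [hother x (by simpa using hx) (by simpa using hx')])
  rw [h.sum_eq_zero] at s1
  simp only [Finset.card_singleton, Nat.cast_one, one_mul] at s1 s2 e1
  have hσ := h.sum_degree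
  have hu2 : y u ^ 2 = 1 := by nlinarith
  have hw2 : y w ^ 2 = 1 := by nlinarith
  rw [s2, hu2, hw2] at hσ
  have hcard : ({u, w} : Finset V).card = 2 := Finset.card_pair huw
  have hsub : ({u, w} : Finset V) ⊆ Qᶜ := by
    intro x hx
    rcases Finset.mem_insert.1 hx with rfl | hx
    · simpa using huQ
    · rw [Finset.mem_singleton.1 hx]; simpa using hwQ
  have hcard' := Finset.card_sdiff_add_card_eq_card hsub
  have hca := h.card_add
  have hQ := h.card_eq
  refine ⟨_, _, TwinType.joinEdge (Qᶜ \ {u, w}).card (by omega) h.one_le ?_ ?_, ?_⟩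
  · by_cases ha : a = 1
    · exact Or.inl ha
    · obtain ⟨x, hx, z, hz, hxz⟩ := Finset.one_lt_card.1 (show 1 < Q.card by
        have := h.one_le; omega)
      exact Or.inr (h.eq_two_mul (h.inner_of_eq_zero hx hz hxz (by simp [h0 x hx])).2)
  · have : (σ : ℝ) = ((Fintype.card V - 2 * a + 2 : ℤ) : ℝ) := by
      rw [hσ]; push_cast; ring
    exact_mod_cast this
  · have hP : ∀ x ∈ Qᶜ \ {u, w}, x ∉ Q ∧ x ≠ u ∧ x ≠ w ∧ y x = 0 := by
      intro x hx
      simp only [Finset.mem_sdiff, Finset.mem_compl, Finset.mem_insert, Finset.mem_singleton,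
        not_or] at hx
      exact ⟨hx.1, hx.2.1, hx.2.2, hother x hx.2.1 hx.2.2⟩
    have hE : ∀ x ∈ ({u, w} : Finset V), x ∉ Q ∧ y x ≠ 0 := by
      intro x hx
      rcases Finset.mem_insert.1 hx with rfl | hx
      · exact ⟨huQ, hu.ne'⟩
      · rw [Finset.mem_singleton.1 hx]; exact ⟨hwQ, hw.ne⟩
    refine isBlowup_looped_three rfl hcard h.card_eq ?_ ?_ ?_ ?_ ?_ ?_ ?_ ?_ ?_ ?_
    · intro x
      simp only [Finset.mem_sdiff, Finset.mem_compl]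
      tauto
    · intro x hx
      exact (Finset.mem_sdiff.1 hx).2
    · exact fun x hx => (hP x hx).1
    · exact fun x hx => (hE x hx).1
    · intro x hx z hz hxz
      simp [h.outer_adj_iff (hP x hx).1 (hP z hz).1 hxz, (hP x hx).2.2.2]
    · intro x hx z hz hxz
      simp [h.outer_adj_iff (hP x hx).1 (hE z hz).1 hxz, (hP x hx).2.2.2]
    · intro x hx z hz hxz
      simp [h.mixed_adj_iff (hP x hx).1 hz, (hP x hx).2.2.2]
    · intro x hx z hz hxz
      simp [h.outer_adj_iff (hE x hx).1 (hE z hz).1 hxz, (hE x hx).2, (hE z hz).2]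
    · intro x hx z hz hxz
      simp [h.mixed_adj_iff (hE x hx).1 hz, h0 z hz]
    · intro x hx z hz hxz
      simp [(h.inner_of_eq_zero hx hz hxz (by simp [h0 x hx])).1]

end IsTwinRep

end TwinRep

end SimpleGraph

namespace SimpleGraph
section TwinRep
variable {V : Type*} [Fintype V] [DecidableEq V]
namespace IsTwinRep
variable {G : SimpleGraph V} {a : ℕ} {σ : ℤ} {ε s : ℝ} {Q : Finset V} {y : V → ℝ}

lemma hasTwinType_of_outer_pos (h : G.IsTwinRep a σ ε s Q y) {u : V} (hu : u ∉ Q) (hu0 : 0 < y u)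
    (hz : ∃ z ∈ Q, y z ≠ 0) : HasTwinType G a σ := by
  obtain ⟨w, hw, hw0⟩ := hz
  have hε0 := h.ne_zero
  have hε2 : ε * ε = 1 := by rcases h.sign with h | h <;> rw [h] <;> norm_num
  have hQv : ∀ z ∈ Q, y z ≠ 0 → y z = ε / y u := by
    intro z hz hz0
    have := h.mixed_mul hu hz (mul_ne_zero hu0.ne' hz0)
    rw [eq_div_iff hu0.ne']
    linear_combination ε * this - (y u * y z) * hε2
  have hPv : ∀ x ∉ Q, y x ≠ 0 → y x = y u := by
    intro x hx hx0
    have e1 := h.mixed_mul hx hw (mul_ne_zero hx0 hw0)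
    have e2 := h.mixed_mul hu hw (mul_ne_zero hu0.ne' hw0)
    rw [← e2] at e1
    exact mul_right_cancel₀ hw0 (mul_left_cancel₀ hε0 e1)
  set P1 := Qᶜ.filter (fun x => y x ≠ 0) with hP1
  set P0 := Qᶜ.filter (fun x => y x = 0) with hP0
  set Q1 := Q.filter (fun x => y x ≠ 0) with hQ1
  set Q0 := Q.filter (fun x => y x = 0) with hQ0
  have mP1 : ∀ x, x ∈ P1 ↔ x ∉ Q ∧ y x ≠ 0 := fun x => by simp [hP1]
  have mP0 : ∀ x, x ∈ P0 ↔ x ∉ Q ∧ y x = 0 := fun x => by simp [hP0]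
  have mQ1 : ∀ x, x ∈ Q1 ↔ x ∈ Q ∧ y x ≠ 0 := fun x => by simp [hQ1]
  have mQ0 : ∀ x, x ∈ Q0 ↔ x ∈ Q ∧ y x = 0 := fun x => by simp [hQ0]
  have cP : P0.card + P1.card = Qᶜ.card := Finset.card_filter_add_card_filter_not _
  have cQ : Q0.card + Q1.card = a := by
    rw [← h.card_eq]
    exact Finset.card_filter_add_card_filter_not _
  have hd : Disjoint P1 Q1 := by
    rw [Finset.disjoint_left]
    intro x hx hx'
    exact ((mP1 x).1 hx).1 ((mQ1 x).1 hx').1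
  have hrest : ∀ x, x ∉ P1 → x ∉ Q1 → y x = 0 := by
    intro x hx hx'
    rw [mP1] at hx
    rw [mQ1] at hx'
    tauto
  have s1 := sum_eq_of_two_values hd (f := y) (v := y u) (w := ε / y u)
    (fun x hx => hPv x ((mP1 x).1 hx).1 ((mP1 x).1 hx).2)
    (fun x hx => hQv x ((mQ1 x).1 hx).1 ((mQ1 x).1 hx).2) hrest
  have s2 := sum_eq_of_two_values hd (f := fun x => y x ^ 2) (v := y u ^ 2) (w := (ε / y u) ^ 2)
    (fun x hx => by rw [hPv x ((mP1 x).1 hx).1 ((mP1 x).1 hx).2])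
    (fun x hx => by rw [hQv x ((mQ1 x).1 hx).1 ((mQ1 x).1 hx).2])
    (fun x hx hx' => by simp [hrest x hx hx'])
  rw [h.sum_eq_zero] at s1
  have uP1 : u ∈ P1 := (mP1 u).2 ⟨hu, hu0.ne'⟩
  have wQ1 : w ∈ Q1 := (mQ1 w).2 ⟨hw, hw0⟩
  have jpos : 0 < P1.card := Finset.card_pos.2 ⟨u, uP1⟩
  have kpos : 0 < Q1.card := Finset.card_pos.2 ⟨w, wQ1⟩
  have hε : ε = -1 := by
    rcases h.sign with h1 | h1
    · rw [h1] at s1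
      have : (0 : ℝ) < P1.card := by exact_mod_cast jpos
      have : (0 : ℝ) < Q1.card := by exact_mod_cast kpos
      have : 0 < P1.card * y u + Q1.card * (1 / y u) :=
        add_pos (mul_pos ‹_› hu0) (mul_pos ‹_› (one_div_pos.2 hu0))
      linarith
    · exact h1
  subst hε
  have hjk : (P1.card : ℝ) * y u ^ 2 = Q1.card := by
    have e1 : -1 / y u * y u = -1 := div_mul_cancel₀ _ hu0.ne'
    linear_combination (-y u) * s1 - (Q1.card : ℝ) * e1
  have hj2 : 2 ≤ P1.card → y u = 1 := by
    intro h2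
    obtain ⟨x, hx, hxu⟩ := Finset.exists_mem_ne h2 u
    have e1 := h.outer_mul ((mP1 x).1 hx).1 hu hxu (mul_ne_zero ((mP1 x).1 hx).2 hu0.ne')
    rw [hPv x ((mP1 x).1 hx).1 ((mP1 x).1 hx).2] at e1
    nlinarith
  have hp2 : 2 ≤ P0.card := by
    obtain ⟨x, hx, z, hz, hxz, hx0, hz0⟩ := h.exists_twins
    exact Finset.one_lt_card.2 ⟨x, (mP0 x).2 ⟨hx, hx0⟩, z, (mP0 z).2 ⟨hz, hz0⟩, hxz⟩
  have hk2 : ∀ x ∈ Q1, ∀ z ∈ Q1, y x * y z = 1 / y u ^ 2 := by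
    intro x hx z hz
    rw [hQv x ((mQ1 x).1 hx).1 ((mQ1 x).1 hx).2, hQv z ((mQ1 z).1 hz).1 ((mQ1 z).1 hz).2]
    ring
  have hinv : (0 : ℝ) < 1 / y u ^ 2 := by positivity
  have hσ : (σ : ℝ) = -(P1.card + Q1.card) + Fintype.card V - 2 * a := by
    rw [h.sum_degree, s2, hjk]
    have : (Q1.card : ℝ) * (-1 / y u) ^ 2 = P1.card := by
      rw [← hjk, mul_assoc, ← mul_pow, mul_div_cancel₀ _ hu0.ne']
      norm_num
    rw [this]
    ring
  have hca := h.card_add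
  have h00 : ∀ x ∈ P0, ∀ z ∈ P0, x ≠ z → (G.Adj x z ↔ false = true) := by
    intro x hx z hz hxz
    rw [mP0] at hx hz
    simp [h.outer_adj_iff hx.1 hz.1 hxz, hx.2]
  have h10 : ∀ x ∈ P1, ∀ z ∈ P0, x ≠ z → (G.Adj x z ↔ false = true) := by
    intro x hx z hz hxz
    rw [mP1] at hx
    rw [mP0] at hz
    simp [h.outer_adj_iff hx.1 hz.1 hxz, hz.2]
  have h11 : ∀ x ∈ P1, ∀ z ∈ P1, x ≠ z → (G.Adj x z ↔ true = true) := by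
    intro x hx z hz hxz
    rw [mP1] at hx hz
    simp [h.outer_adj_iff hx.1 hz.1 hxz, hx.2, hz.2]
  have h0Q : ∀ x ∈ P0, ∀ z ∈ Q, x ≠ z → (G.Adj x z ↔ true = true) := by
    intro x hx z hz hxz
    rw [mP0] at hx
    simp [h.mixed_adj_iff hx.1 hz, hx.2]
  have h1Q1 : ∀ x ∈ P1, ∀ z ∈ Q1, x ≠ z → (G.Adj x z ↔ false = true) := by
    intro x hx z hz hxz
    rw [mP1] at hx
    rw [mQ1] at hz
    simp [h.mixed_adj_iff hx.1 hz.1, hx.2, hz.2]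
  rcases Q0.eq_empty_or_nonempty with hemp | ⟨r, hr⟩
  · have hQQ : Q1 = Q := by
      refine Finset.Subset.antisymm (Finset.filter_subset _ _) fun x hx => ?_
      rw [mQ1]
      refine ⟨hx, fun h0 => ?_⟩
      have : x ∈ Q0 := (mQ0 x).2 ⟨hx, h0⟩
      rw [hemp] at this
      simp at this
    rw [hemp, Finset.card_empty, zero_add] at cQ
    rw [cQ] at kpos hjk hσ
    have hs := h.card_compl_eq
    rw [← cP] at hs
    push_cast at hs
    have hcoclique : ∀ x ∈ Q, ∀ z ∈ Q, x ≠ z → ¬ G.Adj x z ∧ P0.card = a := by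
      intro x hx z hz hxz
      have hyy := hk2 x (hQQ ▸ hx) z (hQQ ▸ hz)
      have hka : 1 / y u ^ 2 * (a : ℝ) = P1.card := by
        rw [← hjk, one_div_mul_eq_div, mul_div_cancel_right₀ _ (pow_pos hu0 2).ne']
      have hp2' : (2 : ℝ) ≤ P0.card := by exact_mod_cast hp2
      by_cases hA : G.Adj x z
      · have e1 := h.inner_adj x hx z hz hA
        rw [hyy] at e1
        have : s = 1 / y u ^ 2 := by linarith
        rw [this] at hs
        linarith
      · have e1 := h.inner_not_adj x hx z hz hxz hA
        rw [hyy] at e1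
        have : s = 1 + 1 / y u ^ 2 := by linarith
        rw [this] at hs
        refine ⟨hA, ?_⟩
        have : (P0.card : ℝ) = a := by linarith
        exact_mod_cast this
    refine ⟨_, _, TwinType.unionBipartite P1.card P0.card (by omega) h.one_le hp2 ?_ ?_, ?_⟩
    · by_cases hj : 2 ≤ P1.card
      · have h1 := hj2 hj
        rw [h1] at hjk
        have hja : P1.card = a := by
          have : (P1.card : ℝ) = a := by linarith
          exact_mod_cast this
        obtain ⟨x, hx, z, hz, hxz⟩ := Finset.one_lt_card.1 (show 1 < Q.card by
          have := h.card_eq; omega)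
        exact Or.inl ⟨hja, (hcoclique x hx z hz hxz).2⟩
      · refine Or.inr ⟨by omega, ?_⟩
        by_cases ha : a = 1
        · exact Or.inr ha
        · obtain ⟨x, hx, z, hz, hxz⟩ := Finset.one_lt_card.1 (show 1 < Q.card by
            have := h.card_eq; have := h.one_le; omega)
          exact Or.inl (hcoclique x hx z hz hxz).2
    · have : (σ : ℝ) = ((P0.card - 2 * a : ℤ) : ℝ) := by
        rw [hσ, ← hca, ← cP]; push_cast; ring
      exact_mod_cast this
    · refine isBlowup_looped_three rfl rfl h.card_eq ?_ ?_ ?_ ?_ h11 h10 ?_ h00 h0Q ?_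
      · intro x
        rw [mP1, mP0]
        tauto
      · exact fun x hx hx' => ((mP1 x).1 hx).2 ((mP0 x).1 hx').2
      · exact fun x hx => ((mP1 x).1 hx).1
      · exact fun x hx => ((mP0 x).1 hx).1
      · exact hQQ ▸ h1Q1
      · intro x hx z hz hxz
        simp [(hcoclique x hx z hz hxz).1]
  · have hrQ := (mQ0 r).1 hr
    have hwr : w ≠ r := by
      rintro rfl
      exact hw0 hrQ.2
    have hs := (h.inner_of_eq_zero hw hrQ.1 hwr (by simp [hrQ.2])).2
    subst hs
    have hclique : ∀ x ∈ Q1, ∀ z ∈ Q1, x ≠ z → G.Adj x z ∧ y u = 1 := by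
      intro x hx z hz hxz
      have hyy := hk2 x hx z hz
      rw [mQ1] at hx hz
      by_cases hA : G.Adj x z
      · have e1 := h.inner_adj x hx.1 z hz.1 hA
        rw [hyy] at e1
        refine ⟨hA, ?_⟩
        have e2 : 1 / y u ^ 2 * y u ^ 2 = 1 := one_div_mul_cancel (pow_pos hu0 2).ne'
        nlinarith
      · have e1 := h.inner_not_adj x hx.1 z hz.1 hxz hA
        rw [hyy] at e1
        linarith
    have hjk' : P1.card = Q1.card := by
      by_cases hj : 2 ≤ P1.card
      · rw [hj2 hj] at hjk
        have : (P1.card : ℝ) = Q1.card := by linarith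
        exact_mod_cast this
      · by_cases hk : 2 ≤ Q1.card
        · obtain ⟨x, hx, z, hz, hxz⟩ := Finset.one_lt_card.1 hk
          rw [(hclique x hx z hz hxz).2] at hjk
          have : (P1.card : ℝ) = Q1.card := by linarith
          exact_mod_cast this
        · omega
    have hn := h.eq_two_mul rfl
    refine ⟨_, _, TwinType.doublePath P0.card Q1.card hn (by omega) hp2 kpos ?_, ?_⟩
    · have : (σ : ℝ) = ((-2 * Q1.card : ℤ) : ℝ) := by
        rw [hσ, hn, hjk']; push_cast; ring
      exact_mod_cast this
    · have hc0 : Q0.card = P0.card := by omega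
      have := isBlowup_looped (G := G) (r00 := false) (r01 := true) (r02 := true) (r03 := false)
        (r11 := false) (r12 := false) (r13 := true) (r22 := true) (r23 := false) (r33 := true)
        P0 Q0 Q1 P1 ?_ ?_ ?_ ?_ ?_ ?_ ?_ h00
        (fun x hx z hz => h0Q x hx z ((mQ0 z).1 hz).1) (fun x hx z hz => h0Q x hx z ((mQ1 z).1 hz).1)
        ?_ ?_ ?_ ?_ ?_ ?_ h11
      · rwa [hc0, hjk'] at this
      · intro x
        rw [mP0, mP1, mQ0, mQ1]
        tauto
      · exact fun x hx hx' => ((mP0 x).1 hx).1 ((mQ0 x).1 hx').1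
      · exact fun x hx hx' => ((mP0 x).1 hx).1 ((mQ1 x).1 hx').1
      · exact fun x hx hx' => ((mP1 x).1 hx').2 ((mP0 x).1 hx).2
      · exact fun x hx hx' => ((mQ1 x).1 hx').2 ((mQ0 x).1 hx).2
      · exact fun x hx hx' => ((mP1 x).1 hx').1 ((mQ0 x).1 hx).1
      · exact fun x hx hx' => ((mP1 x).1 hx').1 ((mQ1 x).1 hx).1
      · exact fun x hx z hz hxz => by rw [G.adj_comm, h10 z hz x hx hxz.symm]
      · intro x hx z hz hxz
        rw [mQ0] at hx hz
        simp [(h.inner_of_eq_zero hx.1 hz.1 hxz (by simp [hx.2])).1]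
      · intro x hx z hz hxz
        rw [mQ0] at hx
        rw [mQ1] at hz
        simp [(h.inner_of_eq_zero hx.1 hz.1 hxz (by simp [hx.2])).1]
      · intro x hx z hz hxz
        rw [mQ0] at hx
        rw [mP1] at hz
        simp [G.adj_comm x z, h.mixed_adj_iff hz.1 hx.1, hx.2]
      · intro x hx z hz hxz
        simp [(hclique x hx z hz hxz).1]
      · exact fun x hx z hz hxz => by rw [G.adj_comm, h1Q1 z hz x hx hxz.symm]

end IsTwinRep

end TwinRep

end SimpleGraph

namespace SimpleGraph
section TwinRep
variable {V : Type*} [Fintype V] [DecidableEq V]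
namespace IsTwinRep
variable {G : SimpleGraph V} {a : ℕ} {σ : ℤ} {ε s : ℝ} {Q : Finset V} {y : V → ℝ}

lemma hasTwinType_of_inner_exists_zero (h : G.IsTwinRep a σ ε s Q y) (h0 : ∀ x ∉ Q, y x = 0)
    (hz : ∃ z ∈ Q, y z = 0) : HasTwinType G a σ := by
  obtain ⟨r, hr, hr0⟩ := hz
  obtain ⟨u, hu⟩ := h.exists_pos
  obtain ⟨w, hw⟩ := h.exists_neg hu
  have huw : u ≠ w := by rintro rfl; linarith
  have hQ : ∀ x, y x ≠ 0 → x ∈ Q := fun x hx => by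
    by_contra h1
    exact hx (h0 x h1)
  have huQ := hQ u hu.ne'
  have hwQ := hQ w hw.ne
  have hur : u ≠ r := by rintro rfl; linarith
  have hs := (h.inner_of_eq_zero huQ hr hur (by simp [hr0])).2
  subst hs
  have hiff : ∀ x ∈ Q, ∀ z ∈ Q, x ≠ z → (G.Adj x z ↔ y x * y z ≠ 0) := by
    intro x hx z hz hxz
    refine ⟨fun h1 h2 => (h.inner_of_eq_zero hx hz hxz h2).1 h1, fun h1 => ?_⟩
    by_contra h2
    have := h.inner_not_adj x hx z hz hxz h2
    rw [sub_self] at this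
    exact h1 ((mul_eq_zero.1 this).resolve_left h.ne_zero)
  have hmul : ∀ x ∈ Q, ∀ z ∈ Q, x ≠ z → y x * y z ≠ 0 → ε * (y x * y z) = -1 :=
    fun x hx z hz hxz h1 => h.inner_adj x hx z hz ((hiff x hx z hz hxz).2 h1)
  have e1 := hmul u huQ w hwQ huw (mul_ne_zero hu.ne' hw.ne)
  have hε : ε = 1 := by
    rcases h.sign with h1 | h1
    · exact h1
    · rw [h1] at e1
      nlinarith
  subst hε
  have hother : ∀ x, x ≠ u → x ≠ w → y x = 0 := by
    intro x hxu hxw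
    by_contra hx
    have e2 := hmul x (hQ x hx) u huQ hxu (mul_ne_zero hx hu.ne')
    have e3 := hmul x (hQ x hx) w hwQ hxw (mul_ne_zero hx hw.ne)
    rcases lt_or_gt_of_ne hx with hx | hx
    · nlinarith
    · nlinarith
  have hd : Disjoint ({u} : Finset V) {w} := by simpa using huw
  have s1 := sum_eq_of_two_values hd (f := y) (v := y u) (w := y w) (by simp) (by simp)
    (fun x hx hx' => hother x (by simpa using hx) (by simpa using hx'))
  have s2 := sum_eq_of_two_values hd (f := fun x => y x ^ 2) (v := y u ^ 2) (w := y w ^ 2)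
    (by simp) (by simp)
    (fun x hx hx' => by simp [hother x (by simpa using hx) (by simpa using hx')])
  rw [h.sum_eq_zero] at s1
  simp only [Finset.card_singleton, Nat.cast_one, one_mul] at s1 s2 e1
  have hσ := h.sum_degree
  have hu2 : y u ^ 2 = 1 := by nlinarith
  have hw2 : y w ^ 2 = 1 := by nlinarith
  rw [s2, hu2, hw2] at hσ
  have hcard : ({u, w} : Finset V).card = 2 := Finset.card_pair huw
  have hE : ∀ x ∈ ({u, w} : Finset V), x ∈ Q ∧ y x ≠ 0 := by
    intro x hx
    rcases Finset.mem_insert.1 hx with rfl | hx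
    · exact ⟨huQ, hu.ne'⟩
    · rw [Finset.mem_singleton.1 hx]; exact ⟨hwQ, hw.ne⟩
  have hP : ∀ x ∈ Q \ {u, w}, x ∈ Q ∧ y x = 0 := by
    intro x hx
    simp only [Finset.mem_sdiff, Finset.mem_insert, Finset.mem_singleton, not_or] at hx
    exact ⟨hx.1, hother x hx.2.1 hx.2.2⟩
  have hcard' := Finset.card_sdiff_add_card_eq_card (fun x hx => (hE x hx).1)
  have hca := h.card_add
  have hQa := h.card_eq
  have hn := h.eq_two_mul rfl
  refine ⟨_, _, TwinType.joinEdge (Q \ {u, w}).card (by omega) h.one_le (Or.inr hn) ?_, ?_⟩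
  · have : (σ : ℝ) = ((Fintype.card V - 2 * a + 2 : ℤ) : ℝ) := by
      rw [hσ]; push_cast; ring
    exact_mod_cast this
  · refine isBlowup_looped_three rfl hcard (S2 := Qᶜ) (by omega) ?_ ?_ ?_ ?_ ?_ ?_ ?_ ?_ ?_ ?_
    · intro x
      simp only [Finset.mem_sdiff, Finset.mem_compl]
      have := fun hx => (hE x hx).1
      tauto
    · intro x hx
      exact (Finset.mem_sdiff.1 hx).2
    · exact fun x hx => by simpa using (hP x hx).1
    · exact fun x hx => by simpa using (hE x hx).1
    · intro x hx z hz hxz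
      simp [hiff x (hP x hx).1 z (hP z hz).1 hxz, (hP x hx).2]
    · intro x hx z hz hxz
      simp [hiff x (hP x hx).1 z (hE z hz).1 hxz, (hP x hx).2]
    · intro x hx z hz hxz
      rw [Finset.mem_compl] at hz
      simp [G.adj_comm x z, h.mixed_adj_iff hz (hP x hx).1, (hP x hx).2]
    · intro x hx z hz hxz
      simp [hiff x (hE x hx).1 z (hE z hz).1 hxz, (hE x hx).2, (hE z hz).2]
    · intro x hx z hz hxz
      rw [Finset.mem_compl] at hz
      simp [G.adj_comm x z, h.mixed_adj_iff hz (hE x hx).1, h0 z hz]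
    · intro x hx z hz hxz
      rw [Finset.mem_compl] at hx hz
      simp [h.outer_adj_iff hx hz hxz, h0 x hx]

/-- The case of exactly two vertices in `Q`. -/
lemma hasTwinType_of_eq_two (h : G.IsTwinRep a σ ε s Q y) (h0 : ∀ x ∉ Q, y x = 0) (ha : a = 2) :
    HasTwinType G a σ := by
  classical
  obtain ⟨u, w, huw, hQ⟩ := Finset.card_eq_two.1 (h.card_eq.trans ha)
  have hu : u ∈ Q := by simp [hQ]
  have hw : w ∈ Q := by simp [hQ]
  have hd : Disjoint ({u} : Finset V) {w} := by simpa using huw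
  have hother : ∀ x, x ≠ u → x ≠ w → y x = 0 := fun x hx hx' => h0 x (by simp [hQ, hx, hx'])
  have s1 := sum_eq_of_two_values hd (f := y) (v := y u) (w := y w) (by simp) (by simp)
    (fun x hx hx' => hother x (by simpa using hx) (by simpa using hx'))
  have s2 := sum_eq_of_two_values hd (f := fun x => y x ^ 2) (v := y u ^ 2) (w := y w ^ 2)
    (by simp) (by simp)
    (fun x hx hx' => by simp [hother x (by simpa using hx) (by simpa using hx')])
  rw [h.sum_eq_zero] at s1
  simp only [Finset.card_singleton, Nat.cast_one, one_mul] at s1 s2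
  have hw' : y w = - y u := by linarith
  have hσ := h.sum_degree
  rw [s2, hw'] at hσ
  have hca := h.card_add
  have hcs := h.card_compl_eq
  have hcn : (Qᶜ.card : ℝ) = Fintype.card V - 2 := by
    rw [← hca, ha]; push_cast; ring
  rw [hcn, ha] at hcs
  rw [ha] at hσ
  push_cast at hcs hσ
  refine ⟨_, _, TwinType.joinPair Qᶜ.card (decide (G.Adj u w)) (by omega) ha ?_, ?_⟩
  · have : (σ : ℝ) =
        ((2 * Fintype.card V - if decide (G.Adj u w) = true then 6 else 8 : ℤ) : ℝ) := by
      rw [hσ]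
      by_cases hA : G.Adj u w
      · have e1 := h.inner_adj u hu w hw hA
        rw [hw'] at e1
        simp only [hA, decide_true, if_true]
        push_cast
        linear_combination -2 * e1 - hcs
      · have e1 := h.inner_not_adj u hu w hw huw hA
        rw [hw'] at e1
        simp only [hA, decide_false, Bool.false_eq_true, if_false]
        push_cast
        linear_combination -2 * e1 - hcs
    exact_mod_cast this
  · refine isBlowup_looped_three rfl (h.card_eq.trans ha) (S2 := ∅) Finset.card_empty
      ?_ ?_ ?_ ?_ ?_ ?_ ?_ ?_ ?_ ?_
    · intro x
      by_cases hx : x ∈ Q <;> simp [hx]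
    · exact fun x hx => by simpa using hx
    · simp
    · simp
    · intro x hx z hz hxz
      rw [Finset.mem_compl] at hx hz
      simp [h.outer_adj_iff hx hz hxz, h0 x hx]
    · intro x hx z hz hxz
      rw [Finset.mem_compl] at hx
      simp [h.mixed_adj_iff hx hz, h0 x hx]
    · simp
    · intro x hx z hz hxz
      rw [hQ] at hx hz
      simp only [Finset.mem_insert, Finset.mem_singleton] at hx hz
      rcases hx with rfl | rfl <;> rcases hz with rfl | rfl
      · exact absurd rfl hxz
      · simp
      · simp [G.adj_comm]
      · exact absurd rfl hxz
    · simp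
    · simp

end IsTwinRep

end TwinRep

end SimpleGraph

namespace SimpleGraph
section TwinRep
variable {V : Type*} [Fintype V] [DecidableEq V]
namespace IsTwinRep
variable {G : SimpleGraph V} {a : ℕ} {σ : ℤ} {ε s : ℝ} {Q : Finset V} {y : V → ℝ}

lemma hasTwinType_of_inner_ne_zero (h : G.IsTwinRep a σ ε s Q y) (h0 : ∀ x ∉ Q, y x = 0)
    (h1 : ∀ x ∈ Q, y x ≠ 0) {u v : V} (huv : u ≠ v) (hu : 0 < y u) (hv : 0 < y v) :
    HasTwinType G a σ := by
  obtain ⟨w, hw⟩ := h.exists_neg hu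
  have hQ : ∀ x, y x ≠ 0 → x ∈ Q := fun x hx => by
    by_contra h1
    exact hx (h0 x h1)
  have huQ := hQ u hu.ne'
  have hvQ := hQ v hv.ne'
  have hwQ := hQ w hw.ne
  have huw : u ≠ w := by rintro rfl; linarith
  have hs := h.pos
  obtain ⟨cp, cn, hpos, hneg⟩ : ∃ cp cn : ℝ,
      (∀ x ∈ Q, ∀ z ∈ Q, x ≠ z → 0 < y x * y z → y x * y z = cp) ∧
      (∀ x ∈ Q, ∀ z ∈ Q, x ≠ z → y x * y z < 0 → y x * y z = cn) ∧
      ((ε = 1 ∧ cp = 1 - s ∧ cn = -s) ∨ (ε = -1 ∧ cp = s ∧ cn = s - 1)) ∧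
      (∀ x ∈ Q, ∀ z ∈ Q, x ≠ z → (G.Adj x z ↔ ε * (y x * y z) < 0)) := by
    have e1 : 0 < y u * y v := mul_pos hu hv
    have e2 : y u * y w < 0 := mul_neg_of_pos_of_neg hu hw
    have hall : ∀ x ∈ Q, ∀ z ∈ Q, x ≠ z →
        (G.Adj x z ∧ ε * (y x * y z) = -s) ∨ (¬ G.Adj x z ∧ ε * (y x * y z) = 1 - s) := by
      intro x hx z hz hxz
      by_cases hA : G.Adj x z
      · exact Or.inl ⟨hA, h.inner_adj x hx z hz hA⟩
      · exact Or.inr ⟨hA, h.inner_not_adj x hx z hz hxz hA⟩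
    have hs1 : s < 1 := by
      rcases h.sign with rfl | rfl
      · rcases hall u huQ v hvQ huv with ⟨-, h2⟩ | ⟨-, h2⟩ <;> linarith
      · rcases hall u huQ w hwQ huw with ⟨-, h2⟩ | ⟨-, h2⟩ <;> linarith
    rcases h.sign with rfl | rfl
    · refine ⟨1 - s, -s, fun x hx z hz hxz h2 => ?_, fun x hx z hz hxz h2 => ?_,
        Or.inl ⟨rfl, rfl, rfl⟩, fun x hx z hz hxz => ?_⟩ <;>
      rcases hall x hx z hz hxz with ⟨h3, h4⟩ | ⟨h3, h4⟩
      · linarith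
      · linarith
      · linarith
      · linarith
      · exact ⟨fun _ => by linarith, fun _ => h3⟩
      · exact ⟨fun h5 => absurd h5 h3, fun _ => by linarith⟩
    · refine ⟨s, s - 1, fun x hx z hz hxz h2 => ?_, fun x hx z hz hxz h2 => ?_,
        Or.inr ⟨rfl, rfl, rfl⟩, fun x hx z hz hxz => ?_⟩ <;>
      rcases hall x hx z hz hxz with ⟨h3, h4⟩ | ⟨h3, h4⟩
      · linarith
      · linarith
      · linarith
      · linarith
      · exact ⟨fun _ => by linarith, fun _ => h3⟩
      · exact ⟨fun h5 => absurd h5 h3, fun _ => by linarith⟩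
  obtain ⟨hneg, hc, hadj⟩ := hneg
  set A := Q.filter (fun x => 0 < y x) with hA
  set B := Q.filter (fun x => ¬ 0 < y x) with hB
  have mA : ∀ x, x ∈ A ↔ x ∈ Q ∧ 0 < y x := fun x => by simp [hA]
  have mB : ∀ x, x ∈ B ↔ x ∈ Q ∧ y x < 0 := fun x => by
    simp only [hB, Finset.mem_filter, not_lt]
    exact ⟨fun hx => ⟨hx.1, lt_of_le_of_ne hx.2 (h1 x hx.1)⟩, fun hx => ⟨hx.1, hx.2.le⟩⟩
  have cAB : A.card + B.card = a := by
    rw [← h.card_eq]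
    exact Finset.card_filter_add_card_filter_not _
  have hd : Disjoint A B := Finset.disjoint_filter_filter_not _ _ _
  have vA : ∀ x ∈ A, y x = y u := by
    intro x hx
    rw [mA] at hx
    have hxw : x ≠ w := by rintro rfl; linarith
    have e1 := hneg x hx.1 w hwQ hxw (mul_neg_of_pos_of_neg hx.2 hw)
    have e2 := hneg u huQ w hwQ huw (mul_neg_of_pos_of_neg hu hw)
    exact mul_right_cancel₀ hw.ne (e1.trans e2.symm)
  have vB : ∀ x ∈ B, y x = y w := by
    intro x hx
    rw [mB] at hx
    have hxu : x ≠ u := by rintro rfl; linarith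
    have e1 := hneg x hx.1 u huQ hxu (mul_neg_of_neg_of_pos hx.2 hu)
    have e2 := hneg w hwQ u huQ huw.symm (mul_neg_of_neg_of_pos hw hu)
    exact mul_right_cancel₀ hu.ne' (e1.trans e2.symm)
  have uA : u ∈ A := (mA u).2 ⟨huQ, hu⟩
  have wB : w ∈ B := (mB w).2 ⟨hwQ, hw⟩
  have hrest : ∀ x, x ∉ A → x ∉ B → y x = 0 := by
    intro x hx hx'
    by_contra h2
    rw [mA] at hx
    rw [mB] at hx'
    rcases lt_or_gt_of_ne h2 with h3 | h3
    · exact hx' ⟨hQ x h2, h3⟩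
    · exact hx ⟨hQ x h2, h3⟩
  have s1 := sum_eq_of_two_values hd vA vB hrest
  have s2 := sum_eq_of_two_values hd (f := fun x => y x ^ 2) (v := y u ^ 2) (w := y w ^ 2)
    (fun x hx => by rw [vA x hx]) (fun x hx => by rw [vB x hx])
    (fun x hx hx' => by simp [hrest x hx hx'])
  rw [h.sum_eq_zero] at s1
  have hi : 2 ≤ A.card := Finset.one_lt_card.2 ⟨u, uA, v, (mA v).2 ⟨hvQ, hv⟩, huv⟩
  have hj : 1 ≤ B.card := Finset.card_pos.2 ⟨w, wB⟩
  have hi' : (2 : ℝ) ≤ A.card := by exact_mod_cast hi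
  have hj' : (1 : ℝ) ≤ B.card := by exact_mod_cast hj
  have hb : y u ^ 2 = cp := by
    have := hpos u huQ v hvQ huv (mul_pos hu hv)
    rw [vA v ((mA v).2 ⟨hvQ, hv⟩)] at this
    linarith
  have hbd : y u * y w = cn := hneg u huQ w hwQ huw (mul_neg_of_pos_of_neg hu hw)
  have hjone : 2 ≤ B.card → A.card = B.card := by
    intro h2
    obtain ⟨x, hx, hxw⟩ := Finset.exists_mem_ne h2 w
    have hxB := (mB x).1 hx
    have e1 := hpos x hxB.1 w hwQ hxw (mul_pos_of_neg_of_neg hxB.2 hw)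
    rw [vB x hx, ← hb] at e1
    have e2 : y w = - y u := by nlinarith
    rw [e2] at s1
    have : (A.card : ℝ) = B.card := by
      apply mul_right_cancel₀ hu.ne'
      linarith
    exact_mod_cast this
  have hca := h.card_add
  have hcs := h.card_compl_eq
  have haR : (a : ℝ) = A.card + B.card := by rw [← cAB]; push_cast; ring
  have hnR : (Fintype.card V : ℝ) = a + Qᶜ.card := by rw [← hca]; push_cast; ring
  have h2c := h.two_le_card_compl
  have hσ := h.sum_degree
  rw [s2] at hσ
  have hcov : ∀ x, x ∈ Qᶜ ∨ x ∈ A ∨ x ∈ B := by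
    intro x
    by_cases hx : x ∈ Q
    · rcases lt_or_gt_of_ne (h1 x hx) with h3 | h3
      · exact Or.inr (Or.inr ((mB x).2 ⟨hx, h3⟩))
      · exact Or.inr (Or.inl ((mA x).2 ⟨hx, h3⟩))
    · simp [hx]
  have h00 : ∀ x ∈ Qᶜ, ∀ z ∈ Qᶜ, x ≠ z → (G.Adj x z ↔ false = true) := by
    intro x hx z hz hxz
    rw [Finset.mem_compl] at hx hz
    simp [h.outer_adj_iff hx hz hxz, h0 x hx]
  have h0A : ∀ x ∈ Qᶜ, ∀ z ∈ A, x ≠ z → (G.Adj x z ↔ true = true) := by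
    intro x hx z hz hxz
    rw [Finset.mem_compl] at hx
    simp [h.mixed_adj_iff hx ((mA z).1 hz).1, h0 x hx]
  have h0B : ∀ x ∈ Qᶜ, ∀ z ∈ B, x ≠ z → (G.Adj x z ↔ true = true) := by
    intro x hx z hz hxz
    rw [Finset.mem_compl] at hx
    simp [h.mixed_adj_iff hx ((mB z).1 hz).1, h0 x hx]
  have d0A : ∀ x ∈ Qᶜ, x ∉ A := fun x hx hx' => (Finset.mem_compl.1 hx) ((mA x).1 hx').1
  have d0B : ∀ x ∈ Qᶜ, x ∉ B := fun x hx hx' => (Finset.mem_compl.1 hx) ((mB x).1 hx').1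
  have dAB : ∀ x ∈ A, x ∉ B := fun x hx => Finset.disjoint_left.1 hd hx
  have pAA : ∀ x ∈ A, ∀ z ∈ A, 0 < y x * y z :=
    fun x hx z hz => mul_pos ((mA x).1 hx).2 ((mA z).1 hz).2
  have pBB : ∀ x ∈ B, ∀ z ∈ B, 0 < y x * y z :=
    fun x hx z hz => mul_pos_of_neg_of_neg ((mB x).1 hx).2 ((mB z).1 hz).2
  have pAB : ∀ x ∈ A, ∀ z ∈ B, y x * y z < 0 :=
    fun x hx z hz => mul_neg_of_pos_of_neg ((mA x).1 hx).2 ((mB z).1 hz).2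
  have hAQ : ∀ x ∈ A, x ∈ Q := fun x hx => ((mA x).1 hx).1
  have hBQ : ∀ x ∈ B, x ∈ Q := fun x hx => ((mB x).1 hx).1
  rcases hc with ⟨rfl, hcp, hcn⟩ | ⟨rfl, hcp, hcn⟩
  · rw [hcp] at hb
    rw [hcn] at hbd
    have hsa : s * a = A.card := by
      rw [haR]
      linear_combination (y u) * s1 + (A.card : ℝ) * hb + (B.card : ℝ) * hbd
    have hci : Qᶜ.card = A.card := by
      have : (Qᶜ.card : ℝ) = A.card := hcs.trans hsa
      exact_mod_cast this
    refine ⟨_, _, TwinType.tripartite A.card B.card (by omega) cAB.symm hi (by omega) ?_, ?_⟩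
    · have : (σ : ℝ) = ((A.card - B.card : ℤ) : ℝ) := by
        rw [hσ, hnR, hci, haR]
        push_cast
        have : (A.card : ℝ) * y u ^ 2 + B.card * y w ^ 2 = A.card := by
          rw [haR] at hsa
          have e3 : (A.card : ℝ) * (y u * y w) = - B.card * y w ^ 2 := by
            linear_combination (-y w) * s1
          rw [hbd] at e3
          rw [hb]
          linarith
        linarith
      exact_mod_cast this
    · refine isBlowup_looped_three hci rfl rfl hcov d0A d0B dAB h00 h0A h0B ?_ ?_ ?_
      · intro x hx z hz hxz
        simpa [hadj x (hAQ x hx) z (hAQ z hz) hxz] using (pAA x hx z hz).le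
      · intro x hx z hz hxz
        simpa [hadj x (hAQ x hx) z (hBQ z hz) hxz] using pAB x hx z hz
      · intro x hx z hz hxz
        simpa [hadj x (hBQ x hx) z (hBQ z hz) hxz] using (pBB x hx z hz).le
  · rw [hcp] at hb
    rw [hcn] at hbd
    have hsa : s * a = B.card := by
      rw [haR]
      linear_combination -(y u) * s1 - (A.card : ℝ) * hb - (B.card : ℝ) * hbd
    have hcj : Qᶜ.card = B.card := by
      have : (Qᶜ.card : ℝ) = B.card := hcs.trans hsa
      exact_mod_cast this
    have hij := hjone (by omega)
    refine ⟨_, _, TwinType.joinCliques A.card (by omega) (by omega) hi ?_, ?_⟩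
    · have : (σ : ℝ) = ((-2 * A.card : ℤ) : ℝ) := by
        rw [hσ, hnR, hcj, haR, ← hij]
        push_cast
        have e2 : y w = - y u := by
          rw [← hij] at s1
          have : (A.card : ℝ) * (y u + y w) = 0 := by linarith
          rcases mul_eq_zero.1 this with h3 | h3 <;> linarith
        rw [haR, ← hij] at hsa
        rw [e2, neg_sq, hb]
        linarith
      exact_mod_cast this
    · refine isBlowup_looped_three (hcj.trans hij.symm) rfl hij.symm hcov d0A d0B dAB h00 h0A h0B
        ?_ ?_ ?_
      · intro x hx z hz hxz
        simpa [hadj x (hAQ x hx) z (hAQ z hz) hxz] using pAA x hx z hz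
      · intro x hx z hz hxz
        simpa [hadj x (hAQ x hx) z (hBQ z hz) hxz] using (pAB x hx z hz).le
      · intro x hx z hz hxz
        simpa [hadj x (hBQ x hx) z (hBQ z hz) hxz] using pBB x hx z hz

/-- The classification of graphs with a twin representation. -/
lemma hasTwinType (h : G.IsTwinRep a σ ε s Q y) : HasTwinType G a σ := by
  by_cases h0 : ∀ x ∉ Q, y x = 0
  · by_cases hz : ∃ z ∈ Q, y z = 0
    · exact h.hasTwinType_of_inner_exists_zero h0 hz
    push Not at hz
    by_cases ha : a = 2
    · exact h.hasTwinType_of_eq_two h0 ha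
    have hQ : ∀ x, y x ≠ 0 → x ∈ Q := fun x hx => by
      by_contra h1
      exact hx (h0 x h1)
    obtain ⟨u, hu⟩ := h.exists_pos
    obtain ⟨w, hw⟩ := h.exists_neg hu
    have huw : u ≠ w := by rintro rfl; linarith
    obtain ⟨x, hx, hxu, hxw⟩ : ∃ x ∈ Q, x ≠ u ∧ x ≠ w := by
      by_contra! h1
      have h2 : Q = {u, w} := by
        ext x
        rw [Finset.mem_insert, Finset.mem_singleton]
        refine ⟨fun hx => ?_, ?_⟩
        · by_contra! h3
          exact h3.2 (h1 x hx h3.1)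
        · rintro (rfl | rfl)
          exacts [hQ _ hu.ne', hQ _ hw.ne]
      exact ha (by rw [← h.card_eq, h2, Finset.card_pair huw])
    rcases lt_or_gt_of_ne (hz x hx) with h1 | h1
    · exact h.neg.hasTwinType_of_inner_ne_zero (u := x) (v := w) (by simpa using h0)
        (by simpa using hz) hxw (by simpa using h1) (by simpa using hw)
    · exact h.hasTwinType_of_inner_ne_zero h0 hz hxu h1 hu
  · push Not at h0
    obtain ⟨u, hu, hu0⟩ := h0
    by_cases hz : ∀ z ∈ Q, y z = 0
    · exact h.hasTwinType_of_inner_eq_zero hz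
    push Not at hz
    rcases lt_or_gt_of_ne hu0 with h1 | h1
    · exact h.neg.hasTwinType_of_outer_pos hu (by simpa using h1) (by simpa using hz)
    · exact h.hasTwinType_of_outer_pos hu h1 hz

end IsTwinRep

end TwinRep

end SimpleGraph

namespace Matrix

variable {V : Type*} [Fintype V] {M : Matrix V V ℝ}

lemma det_three_eq_zero (hM : M.rank ≤ 2) (x y z r s t : V) :
    M x r * M y s * M z t - M x r * M y t * M z s - M x s * M y r * M z t +
      M x s * M y t * M z r + M x t * M y r * M z s - M x t * M y s * M z r = 0 := by
  have := det_submatrix_fin_three_eq_zero hM ![x, y, z] ![r, s, t]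
  rw [det_fin_three] at this
  simpa using this

/-- Splitting off a nonzero diagonal entry from a symmetric matrix of rank two leaves `± y yᵀ`. -/
lemma exists_eq_add_rank_one (hM : M.rank = 2) (hs : ∀ x t, M x t = M t x) {p : V}
    (hp : M p p ≠ 0) : ∃ (ε : ℝ) (y : V → ℝ), (ε = 1 ∨ ε = -1) ∧ (∃ x, y x ≠ 0) ∧
      (∀ x t, M x t = M p x * M p t / M p p + ε * (y x * y t)) := by
  obtain ⟨U, hU⟩ : ∃ U : V → V → ℝ, ∀ x t, U x t = M x t - M p x * M p t / M p p :=
    ⟨_, fun _ _ => rfl⟩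
  have hmul : ∀ x z t w, U x t * U z w = U x w * U z t := by
    intro x z t w
    have h1 := det_three_eq_zero hM.le p x z p t w
    simp only [hU]
    rw [hs x p, hs z p] at h1
    field_simp
    linear_combination M p p * h1
  have hsym : ∀ x t, U x t = U t x := by
    intro x t
    rw [hU, hU, hs x t]
    ring
  obtain ⟨x, hx⟩ : ∃ x, U x x ≠ 0 := by
    by_contra! h0
    have h1 : ∀ x t, U x t = 0 := by
      intro x t
      have := hmul x t t x
      rw [h0, h0, hsym t x, mul_zero] at this
      exact mul_self_eq_zero.1 this
    have h2 : M = vecMulVec (fun x => M p x / M p p) (fun t => M p t) := by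
      ext x t
      have := h1 x t
      rw [hU] at this
      rw [vecMulVec_apply]
      linear_combination this
    have h3 := rank_vecMulVec_le (fun x => M p x / M p p) (fun t => M p t)
    rw [← h2] at h3
    omega
  have hr : √|U x x| * √|U x x| = |U x x| := Real.mul_self_sqrt (abs_nonneg _)
  have hr0 : √|U x x| ≠ 0 := (Real.sqrt_pos.2 (abs_pos.2 hx)).ne'
  obtain ⟨ε, hε, hεd⟩ : ∃ ε : ℝ, (ε = 1 ∨ ε = -1) ∧ U x x = ε * |U x x| := by
    rcases le_or_gt 0 (U x x) with h | h
    · exact ⟨1, Or.inl rfl, by rw [abs_of_nonneg h, one_mul]⟩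
    · exact ⟨-1, Or.inr rfl, by rw [abs_of_neg h]; ring⟩
  have hε2 : ε * ε = 1 := by rcases hε with h | h <;> rw [h] <;> norm_num
  refine ⟨ε, fun z => U x z / √|U x x|, hε, ⟨x, div_ne_zero hx hr0⟩, fun z t => ?_⟩
  have h1 := hmul x z x t
  rw [hsym z x] at h1
  have h2 := hU z t
  have h3 : U z t = ε * (U x z / √|U x x| * (U x t / √|U x x|)) := by
    rw [div_mul_div_comm, hr]
    rw [hεd] at h1
    field_simp
    linear_combination ε * h1 - U z t * |U x x| * hε2
  rw [← h3, h2]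
  ring

end Matrix

namespace SimpleGraph

variable {V : Type*} [Fintype V] [DecidableEq V] {G : SimpleGraph V} [DecidableRel G.Adj]
  {α : ℝ}

lemma degree_eq_of_shiftedLap_eq {p q : V} (hpq : p ≠ q) (hadj : ¬ G.Adj p q)
    (h : ∀ x, G.shiftedLap α p x = G.shiftedLap α q x) : (G.degree p : ℝ) = α := by
  have h1 := h p
  rw [shiftedLap_self, shiftedLap_of_ne _ _ hpq.symm, if_neg fun hA => hadj hA.symm] at h1
  linarith

/-- Nonadjacent twins give rise to a twin representation. -/
lemma exists_isTwinRep (hα : 0 < α) (hα' : α < Fintype.card V) (hM : (G.shiftedLap α).rank = 2)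
    {p q : V} (hpq : p ≠ q) (hadj : ¬ G.Adj p q)
    (h : ∀ x, G.shiftedLap α p x = G.shiftedLap α q x) :
    ∃ ε s Q y, G.IsTwinRep (G.degree p) (∑ u, ((G.degree u : ℤ) - G.degree p)) ε s Q y := by
  have hd := degree_eq_of_shiftedLap_eq hpq hadj h
  have hn : (0 : ℝ) < Fintype.card V := hα.trans hα'
  obtain ⟨c, hc⟩ : ∃ c, c = α / Fintype.card V := ⟨_, rfl⟩
  have hc0 : 0 < c := hc ▸ div_pos hα hn
  have hc1 : c < 1 := by rw [hc, div_lt_one hn]; exact hα'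
  have hpp : G.shiftedLap α p p = c := by rw [shiftedLap_self, hd, hc]; ring
  obtain ⟨ε, y, hε, hy, hMy⟩ := Matrix.exists_eq_add_rank_one hM (G.shiftedLap_comm α)
    (hpp ▸ hc0.ne')
  rw [hpp] at hMy
  set Q := G.neighborFinset p with hQ
  have hout : ∀ x ∉ Q, G.shiftedLap α p x = c := by
    intro x hx
    by_cases hxp : x = p
    · rw [hxp, hpp]
    · rw [shiftedLap_of_ne _ _ (Ne.symm hxp), if_neg (by simpa [hQ] using hx), sub_zero, hc]
  have hin : ∀ x ∈ Q, G.shiftedLap α p x = c - 1 := by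
    intro x hx
    rw [hQ, mem_neighborFinset] at hx
    rw [shiftedLap_of_ne _ _ hx.ne, if_pos hx, hc]
  have hpQ : p ∉ Q := by simp [hQ]
  have hqQ : q ∉ Q := by simpa [hQ] using hadj
  have hε0 : ε ≠ 0 := by rcases hε with h | h <;> rw [h] <;> norm_num
  have hyp : y p = 0 := by
    have := hMy p p
    rw [hpp] at this
    field_simp at this
    have h2 : ε * y p ^ 2 = 0 := by linarith
    simpa [hε0] using h2
  have hyq : y q = 0 := by
    obtain ⟨x, hx⟩ := hy
    have h1 := hMy q x
    rw [← h x, hout q hqQ, mul_div_cancel_left₀ _ hc0.ne'] at h1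
    simpa [hε0, hx] using h1
  have hadjval : ∀ {x z}, G.Adj x z → G.shiftedLap α x z = c - 1 := by
    intro x z hxz
    rw [shiftedLap_of_ne _ _ hxz.ne, if_pos hxz, hc]
  have hnadjval : ∀ {x z}, x ≠ z → ¬ G.Adj x z → G.shiftedLap α x z = c := by
    intro x z hxz hA
    rw [shiftedLap_of_ne _ _ hxz, if_neg hA, hc, sub_zero]
  have hcard : Q.card = G.degree p := G.card_neighborFinset_eq_degree p
  have hα'' : c * Fintype.card V = α := by rw [hc]; field_simp
  refine ⟨ε, 1 / c - 1, Q, y, ⟨hε, ?_, hcard, ?_, hy, ?_, ⟨p, hpQ, q, hqQ, hpq, hyp, hyq⟩,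
    ?_, ?_, ?_, ?_, ?_, ?_, ?_⟩⟩
  · rw [sub_pos, lt_div_iff₀ hc0]
    linarith
  · have : (Qᶜ.card : ℝ) = Fintype.card V - α := by
      rw [← hd, ← hcard, ← Finset.card_add_card_compl Q]
      push_cast
      ring
    rw [this, hd, ← hα'']
    field_simp
  · obtain ⟨x, hx⟩ := hy
    have h1 := G.sum_shiftedLap α x
    have h2 := G.sum_shiftedLap α p
    rw [Finset.sum_congr rfl (fun t _ => hMy x t), Finset.sum_add_distrib, ← Finset.sum_div,
      ← Finset.mul_sum, h2, ← Finset.mul_sum, ← Finset.mul_sum] at h1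
    simpa [hε0, hx] using h1
  · intro x hx z hz hA
    have := hMy x z
    rw [hadjval hA, hout x hx, hout z hz] at this
    field_simp at this
    linarith
  · intro x hx z hz hxz hA
    have := hMy x z
    rw [hnadjval hxz hA, hout x hx, hout z hz] at this
    field_simp at this
    have h3 : ε * (y x * y z) = 0 := by linarith
    exact (mul_eq_zero.1 h3).resolve_left hε0
  · intro x hx z hz hA
    have := hMy x z
    rw [hadjval hA, hout x hx, hin z hz] at this
    field_simp at this
    have h3 : ε * (y x * y z) = 0 := by linarith
    exact (mul_eq_zero.1 h3).resolve_left hε0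
  · intro x hx z hz hA
    have hxz : x ≠ z := by rintro rfl; exact hx hz
    have := hMy x z
    rw [hnadjval hxz hA, hout x hx, hin z hz] at this
    field_simp at this
    linarith
  · intro x hx z hz hA
    have := hMy x z
    rw [hadjval hA, hin x hx, hin z hz] at this
    field_simp
    field_simp at this
    linear_combination -this
  · intro x hx z hz hxz hA
    have := hMy x z
    rw [hnadjval hxz hA, hin x hx, hin z hz] at this
    field_simp
    field_simp at this
    linear_combination -this
  · have hdeg : ∀ u, (G.degree u : ℝ) - G.degree p =
        ε * y u ^ 2 + if u ∈ Q then 1 / c - 2 else 0 := by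
      intro u
      have := hMy u u
      rw [shiftedLap_self, ← hc] at this
      rw [hd]
      split_ifs with hu
      · rw [hin u hu] at this
        field_simp
        field_simp at this
        linear_combination this
      · rw [hout u hu] at this
        field_simp at this
        linear_combination this
    push_cast
    rw [Finset.sum_congr rfl (fun u _ => hdeg u), Finset.sum_add_distrib, ← Finset.mul_sum,
      ← Finset.sum_filter, Finset.filter_mem_eq_inter, Finset.univ_inter, Finset.sum_const, hcard,
      nsmul_eq_mul, hd, ← hα'']
    field_simp
    ring

end SimpleGraph

namespace Matrix

variable {V : Type*} [Fintype V] {M : Matrix V V ℝ}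

lemma exists_two_minor_ne_zero [DecidableEq V] (hM : M.rank = 2) (hs : ∀ x t, M x t = M t x) :
    ∃ p q, p ≠ q ∧ M p p * M q q - M p q ^ 2 ≠ 0 := by
  by_cases h : ∃ p, M p p ≠ 0
  · obtain ⟨p, hp⟩ := h
    obtain ⟨ε, y, hε, ⟨q, hq⟩, hMy⟩ := exists_eq_add_rank_one hM hs hp
    have hε0 : ε ≠ 0 := by rcases hε with h | h <;> rw [h] <;> norm_num
    have h1 : M p p * M q q - M p q ^ 2 = M p p * (ε * (y q * y q)) := by
      have := hMy q q
      rw [this]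
      field_simp
      ring
    refine ⟨p, q, ?_, ?_⟩
    · rintro rfl
      rw [sub_eq_zero.2 (sq (M p p)).symm] at h1
      simp [hp, hε0, hq] at h1
    · rw [h1]
      simp [hp, hε0, hq]
  · push Not at h
    obtain ⟨p, q, hpq⟩ : ∃ p q, M p q ≠ 0 := by
      by_contra! h0
      have : M = 0 := by ext x y; exact h0 x y
      rw [this, rank_zero] at hM
      omega
    refine ⟨p, q, ?_, ?_⟩
    · rintro rfl
      exact hpq (h p)
    · rw [h, zero_mul, zero_sub]
      exact neg_ne_zero.2 (pow_ne_zero 2 hpq)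

lemma two_minor_mul (hM : M.rank = 2) (hs : ∀ x t, M x t = M t x) (p q x t : V) :
    (M p p * M q q - M p q ^ 2) * M x t = M q q * M p x * M p t -
      M p q * (M p x * M q t + M q x * M p t) + M p p * M q x * M q t := by
  have h := det_three_eq_zero hM.le p q x p q t
  rw [hs x p, hs x q, hs q p] at h
  linear_combination h

lemma row_eq_of_two_minor_ne_zero (hM : M.rank = 2) (hs : ∀ x t, M x t = M t x) {p q x z : V}
    (hD : M p p * M q q - M p q ^ 2 ≠ 0) (hp : M p x = M p z) (hq : M q x = M q z) (t : V) :
    M x t = M z t := by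
  have h1 := two_minor_mul hM hs p q x t
  rw [hp, hq, ← two_minor_mul hM hs p q z t] at h1
  exact mul_left_cancel₀ hD h1

/-- If a principal minor of size two of a symmetric matrix of rank two vanishes, the corresponding
rows are proportional. -/
lemma row_mul_eq_of_two_minor_eq_zero [DecidableEq V] (hM : M.rank = 2)
    (hs : ∀ x t, M x t = M t x) {u x : V} (hux : M u u * M x x - M u x ^ 2 = 0) (s t : V) :
    M u s * M x t = M u t * M x s := by
  obtain ⟨p, q, -, hD⟩ := exists_two_minor_ne_zero hM hs
  have F := two_minor_mul hM hs p q
  have key : ∀ s t, (M p p * M q q - M p q ^ 2) ^ 2 * (M u s * M x t - M u t * M x s) =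
      (M p p * M q q - M p q ^ 2) * ((M p u * M q x - M q u * M p x) *
        (M p s * M q t - M q s * M p t)) := by
    intro s t
    linear_combination ((M p p * M q q - M p q ^ 2) * M x t) * F u s + (M q q * M p u * M p s -
      M p q * (M p u * M q s + M q u * M p s) + M p p * M q u * M q s) * F x t -
      ((M p p * M q q - M p q ^ 2) * M x s) * F u t - (M q q * M p u * M p t -
      M p q * (M p u * M q t + M q u * M p t) + M p p * M q u * M q t) * F x s
  have h1 := key u x
  have h2 : M u u * M x x - M u x * M x u = 0 := by rw [hs x u, ← hux]; ring
  rw [h2, mul_zero] at h1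
  have h3 : (M p u * M q x - M q u * M p x) = 0 := by
    have := (mul_eq_zero.1 h1.symm).resolve_left hD
    exact mul_self_eq_zero.1 this
  have h4 := key s t
  rw [h3, zero_mul, mul_zero] at h4
  exact sub_eq_zero.1 ((mul_eq_zero.1 h4).resolve_left (pow_ne_zero 2 hD))

end Matrix

namespace SimpleGraph

variable {V : Type*} [Fintype V] [DecidableEq V] {G : SimpleGraph V} [DecidableRel G.Adj]
  {α : ℝ}

lemma row_eq_of_pattern_eq (hM : (G.shiftedLap α).rank = 2) {p q x z : V}
    (hD : G.shiftedLap α p p * G.shiftedLap α q q - G.shiftedLap α p q ^ 2 ≠ 0)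
    (hx : x ≠ p ∧ x ≠ q) (hz : z ≠ p ∧ z ≠ q)
    (h : (decide (G.Adj p x), decide (G.Adj q x)) = (decide (G.Adj p z), decide (G.Adj q z)))
    (t : V) : G.shiftedLap α x t = G.shiftedLap α z t := by
  simp only [Prod.mk.injEq, decide_eq_decide] at h
  refine Matrix.row_eq_of_two_minor_ne_zero hM (G.shiftedLap_comm α) hD ?_ ?_ t
  · simp only [shiftedLap_of_ne _ _ hx.1.symm, shiftedLap_of_ne _ _ hz.1.symm, h.1]
  · simp only [shiftedLap_of_ne _ _ hx.2.symm, shiftedLap_of_ne _ _ hz.2.symm, h.2]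

/-- On six vertices, without twins, a nonsingular pair determines the degree of its members. -/
lemma degree_eq_of_forall_ne (hV : Fintype.card V = 6) (hM : (G.shiftedLap α).rank = 2)
    (hno : ∀ x z, x ≠ z → ∃ t, G.shiftedLap α x t ≠ G.shiftedLap α z t) {p q : V} (hpq : p ≠ q)
    (hD : G.shiftedLap α p p * G.shiftedLap α q q - G.shiftedLap α p q ^ 2 ≠ 0) :
    G.degree p = 2 + if G.Adj p q then 1 else 0 := by
  let f : {x : V // x ≠ p ∧ x ≠ q} → Bool × Bool :=
    fun x => (decide (G.Adj p x), decide (G.Adj q x))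
  have hf : Function.Injective f := by
    intro x z hxz
    by_contra hne
    obtain ⟨t, ht⟩ := hno x z (fun h => hne (Subtype.ext h))
    exact ht (row_eq_of_pattern_eq hM hD x.2 z.2 hxz t)
  have hcard : Fintype.card {x : V // x ≠ p ∧ x ≠ q} = 4 := by
    rw [Fintype.card_subtype]
    have : (Finset.univ.filter fun x => x ≠ p ∧ x ≠ q) = ({p, q} : Finset V)ᶜ := by
      ext x; simp
    rw [this, Finset.card_compl, hV, Finset.card_pair hpq]
  have hbij : Function.Bijective f :=
    (Fintype.bijective_iff_injective_and_card f).2 ⟨hf, by rw [hcard]; rfl⟩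
  have h1 : (Finset.univ.filter fun x : {x : V // x ≠ p ∧ x ≠ q} => G.Adj p x).card = 2 := by
    have h2 : (Finset.univ.filter fun b : Bool × Bool => b.1 = true).card = 2 := by decide
    rw [← h2]
    refine Finset.card_bij (fun x _ => f x) (fun x hx => ?_) (fun x _ z _ h => hf h)
      (fun b hb => ?_)
    · simpa [f] using hx
    · obtain ⟨x, rfl⟩ := hbij.2 b
      exact ⟨x, by simpa [f] using hb, rfl⟩
  have h3 : (Finset.univ.filter fun x : {x : V // x ≠ p ∧ x ≠ q} => G.Adj p x).card =
      ((G.neighborFinset p).erase q).card := by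
    refine Finset.card_bij (fun x _ => x.1) (fun x hx => ?_) (fun x _ z _ h => Subtype.ext h)
      (fun b hb => ?_)
    · simpa [x.2.2] using hx
    · rw [Finset.mem_erase, mem_neighborFinset] at hb
      exact ⟨⟨b, hb.2.ne', hb.1⟩, by simpa using hb.2, rfl⟩
  rw [h1] at h3
  split_ifs with hA
  · rw [Finset.card_erase_of_mem (by simpa using hA), card_neighborFinset_eq_degree] at h3
    omega
  · rw [Finset.erase_eq_of_notMem (by simpa using hA), card_neighborFinset_eq_degree] at h3
    omega

lemma exists_twins (hα : 0 < α) (hα' : α < Fintype.card V) (hV : 6 ≤ Fintype.card V)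
    (hM : (G.shiftedLap α).rank = 2) :
    ∃ p q, p ≠ q ∧ ∀ x, G.shiftedLap α p x = G.shiftedLap α q x := by
  have hs := G.shiftedLap_comm α
  rcases hV.lt_or_eq with hV | hV
  · obtain ⟨p, q, hpq, hD⟩ := Matrix.exists_two_minor_ne_zero hM hs
    have hcard : Fintype.card (Bool × Bool) < (({p, q} : Finset V)ᶜ).card := by
      rw [Finset.card_compl, Finset.card_pair hpq]
      simp only [Fintype.card_prod, Fintype.card_bool]
      omega
    obtain ⟨x, hx, z, hz, hxz, h⟩ := Finset.exists_ne_map_eq_of_card_lt_of_maps_to hcard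
      (f := fun x => (decide (G.Adj p x), decide (G.Adj q x))) (fun x _ => Finset.mem_univ _)
    refine ⟨x, z, hxz, row_eq_of_pattern_eq hM hD (by simpa using hx) (by simpa using hz) h⟩
  · by_contra! hno
    have hn : (0 : ℝ) < Fintype.card V := hα.trans hα'
    obtain ⟨c, hc⟩ : ∃ c, c = α / Fintype.card V := ⟨_, rfl⟩
    have hc0 : 0 < c := hc ▸ div_pos hα hn
    have hc1 : c < 1 := by rw [hc, div_lt_one hn]; exact hα'
    have hval : ∀ {x t}, x ≠ t → G.shiftedLap α x t = c ∨ G.shiftedLap α x t = c - 1 := by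
      intro x t hxt
      rw [shiftedLap_of_ne _ _ hxt, ← hc]
      split_ifs
      · exact Or.inr rfl
      · exact Or.inl (sub_zero _)
    have hval0 : ∀ {x t}, x ≠ t → G.shiftedLap α x t ≠ 0 := by
      intro x t hxt
      rcases hval hxt with h | h <;> rw [h]
      · exact hc0.ne'
      · linarith
    have : Nonempty V := Fintype.card_pos_iff.1 (by omega)
    obtain ⟨u⟩ := this
    let Z := Finset.univ.filter fun x => x ≠ u ∧
      G.shiftedLap α u u * G.shiftedLap α x x - G.shiftedLap α u x ^ 2 = 0
    have hZ : Z.card ≤ 1 := by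
      by_contra! hZ
      obtain ⟨x, hx, z, hz, hxz⟩ := Finset.one_lt_card.1 hZ
      simp only [Z, Finset.mem_filter, Finset.mem_univ, true_and] at hx hz
      obtain ⟨t, ht⟩ : ∃ t, t ∉ ({u, x, z} : Finset V) := by
        by_contra! h
        have h1 : (Finset.univ : Finset V) ⊆ {u, x, z} := fun t _ => h t
        have h2 := Finset.card_le_card h1
        have h3 := Finset.card_le_three (a := u) (b := x) (c := z)
        rw [Finset.card_univ] at h2
        omega
      simp only [Finset.mem_insert, Finset.mem_singleton, not_or] at ht
      have px := fun s => Matrix.row_mul_eq_of_two_minor_eq_zero hM hs hx.2 s t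
      have pz := fun s => Matrix.row_mul_eq_of_two_minor_eq_zero hM hs hz.2 s t
      have h1 : G.shiftedLap α u t = G.shiftedLap α x t ∨ G.shiftedLap α u t = G.shiftedLap α z t ∨
          G.shiftedLap α x t = G.shiftedLap α z t := by
        rcases hval (Ne.symm ht.1) with h1 | h1 <;> rcases hval (Ne.symm ht.2.1) with h2 | h2 <;>
          rcases hval (Ne.symm ht.2.2) with h3 | h3 <;> rw [h1, h2, h3] <;> simp
      have hu0 := hval0 (Ne.symm ht.1)
      rcases h1 with h1 | h1 | h1
      · obtain ⟨s, hs'⟩ := hno u x (Ne.symm hx.1)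
        have := px s
        rw [← h1, mul_comm] at this
        exact hs' (mul_left_cancel₀ hu0 this)
      · obtain ⟨s, hs'⟩ := hno u z (Ne.symm hz.1)
        have := pz s
        rw [← h1, mul_comm] at this
        exact hs' (mul_left_cancel₀ hu0 this)
      · obtain ⟨s, hs'⟩ := hno x z hxz
        have h2 := px s
        rw [h1, pz s] at h2
        exact hs' (mul_left_cancel₀ hu0 h2.symm)
    have hdeg : ∀ x, x ≠ u → x ∉ Z → G.degree u = 2 + if G.Adj u x then 1 else 0 := by
      intro x hxu hx
      simp only [Z, Finset.mem_filter, Finset.mem_univ, true_and, not_and] at hx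
      exact degree_eq_of_forall_ne hV.symm hM hno (Ne.symm hxu) (hx hxu)
    have hS : 4 ≤ ((insert u Z)ᶜ).card := by
      rw [Finset.card_compl]
      have := Finset.card_insert_le u Z
      omega
    obtain ⟨x, hx⟩ := Finset.card_pos.1 (show 0 < ((insert u Z)ᶜ).card by omega)
    have hx' := hx
    rw [Finset.mem_compl, Finset.mem_insert, not_or] at hx'
    have hdx := hdeg x hx'.1 hx'.2
    have hsame : ∀ z ∈ (insert u Z)ᶜ, (G.Adj u z ↔ G.Adj u x) := by
      intro z hz
      rw [Finset.mem_compl, Finset.mem_insert, not_or] at hz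
      have hdz := hdeg z hz.1 hz.2
      rw [hdx] at hdz
      by_cases h1 : G.Adj u x <;> by_cases h2 : G.Adj u z <;> simp [h1, h2] at hdz ⊢
    by_cases hA : G.Adj u x
    · have h1 : (insert u Z)ᶜ ⊆ G.neighborFinset u := fun z hz => by
        rw [mem_neighborFinset]
        exact (hsame z hz).2 hA
      have h2 := Finset.card_le_card h1
      rw [card_neighborFinset_eq_degree, hdx, if_pos hA] at h2
      omega
    · have h1 : G.neighborFinset u ⊆ Z := fun z hz => by
        rw [mem_neighborFinset] at hz
        by_contra h3
        have h4 : z ∈ (insert u Z)ᶜ := by simp [hz.ne', h3]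
        exact hA ((hsame z h4).1 hz)
      have h2 := Finset.card_le_card h1
      rw [card_neighborFinset_eq_degree, hdx, if_neg hA] at h2
      omega

end SimpleGraph

lemma Matrix.rank_neg {m n R : Type*} [Fintype n] [CommRing R] (M : Matrix m n R) :
    (-M).rank = M.rank := by
  have h : (-M).mulVecLin = -M.mulVecLin := by
    refine LinearMap.ext fun x => ?_
    simp
  rw [Matrix.rank, Matrix.rank, h, LinearMap.range_neg]

namespace SimpleGraph

lemma nonempty_iso_of_compl {V W : Type*} {G : SimpleGraph V} {H : SimpleGraph W}
    (h : Nonempty (Gᶜ ≃g Hᶜ)) : Nonempty (G ≃g H) := by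
  obtain ⟨e⟩ := h
  refine ⟨⟨e.toEquiv, fun {u w} => ?_⟩⟩
  have h1 := e.map_adj_iff (v := u) (w := w)
  rw [compl_adj, compl_adj] at h1
  have h2 : e u ≠ e w ↔ u ≠ w := e.injective.ne_iff
  by_cases huw : u = w
  · simp [huw]
  · have h3 := h2.2 huw
    change H.Adj (e u) (e w) ↔ _
    tauto

variable {V : Type*} [Fintype V] [DecidableEq V] {G H : SimpleGraph V} [DecidableRel G.Adj]
  [DecidableRel H.Adj] {α : ℝ}

lemma hasTwinType_or_compl (hα : 0 < α) (hα' : α < Fintype.card V) (hV : 6 ≤ Fintype.card V)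
    (h : (G.lapMatrix ℝ - α • (1 : Matrix V V ℝ)).rank = 3) :
    (∃ a : ℕ, (a : ℝ) = α ∧ IsTwinRep.HasTwinType G a (∑ u, ((G.degree u : ℤ) - a))) ∨
    (∃ a : ℕ, (a : ℝ) = Fintype.card V - α ∧
      IsTwinRep.HasTwinType Gᶜ a (∑ u, ((Gᶜ.degree u : ℤ) - a))) := by
  have : Nonempty V := Fintype.card_pos_iff.1 (by omega)
  have hM := G.rank_shiftedLap α hα.ne' h
  obtain ⟨p, q, hpq, htw⟩ := exists_twins hα hα' hV hM
  by_cases hA : G.Adj p q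
  · right
    have hMc : (Gᶜ.shiftedLap (Fintype.card V - α)).rank = 2 := by
      rw [shiftedLap_compl, Matrix.rank_neg, hM]
    have hAc : ¬ Gᶜ.Adj p q := fun h => ((G.compl_adj p q).1 h).2 hA
    have htw' : ∀ x, Gᶜ.shiftedLap (Fintype.card V - α) p x =
        Gᶜ.shiftedLap (Fintype.card V - α) q x := by
      intro x
      rw [shiftedLap_compl, Matrix.neg_apply, Matrix.neg_apply, htw]
    obtain ⟨ε, s, Q, y, hrep⟩ := exists_isTwinRep (by linarith) (by linarith) hMc hpq hAc htw'
    exact ⟨_, degree_eq_of_shiftedLap_eq hpq hAc htw', hrep.hasTwinType⟩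
  · left
    obtain ⟨ε, s, Q, y, hrep⟩ := exists_isTwinRep hα hα' hM hpq hA htw
    exact ⟨_, degree_eq_of_shiftedLap_eq hpq hA htw, hrep.hasTwinType⟩

lemma sum_degree_compl_sub (a b : ℕ) (h : b = Fintype.card V - a) (ha : a ≤ Fintype.card V) :
    ∑ u, ((Gᶜ.degree u : ℤ) - b) = - Fintype.card V - ∑ u, ((G.degree u : ℤ) - a) := by
  have h1 : ∀ u, ((Gᶜ.degree u : ℤ) - b) = -1 - ((G.degree u : ℤ) - a) := by
    intro u
    have := G.degree_lt_card_verts u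
    rw [degree_compl, h]
    omega
  rw [Finset.sum_congr rfl fun u _ => h1 u, Finset.sum_sub_distrib]
  simp

/-- Graphs with the same eigenvalue `0 < α < n` of multiplicity `n - 3` and the same number of
edges are isomorphic. -/
lemma nonempty_iso_of_lt_card (hα : 0 < α) (hα' : α < Fintype.card V) (hV : 6 ≤ Fintype.card V)
    (hG : (G.lapMatrix ℝ - α • (1 : Matrix V V ℝ)).rank = 3)
    (hH : (H.lapMatrix ℝ - α • (1 : Matrix V V ℝ)).rank = 3)
    (hdeg : ∑ u, (G.degree u : ℤ) = ∑ u, (H.degree u : ℤ)) : Nonempty (G ≃g H) := by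
  have hσ : ∀ a : ℕ, ∑ u, ((H.degree u : ℤ) - a) = ∑ u, ((G.degree u : ℤ) - a) := by
    intro a
    rw [Finset.sum_sub_distrib, Finset.sum_sub_distrib, hdeg]
  have hlt : ∀ {a b : ℕ}, (a : ℝ) = α → (b : ℝ) = Fintype.card V - α →
      a < Fintype.card V ∧ b = Fintype.card V - a := by
    intro a b ha hb
    have h1 : a < Fintype.card V := by rw [← ha] at hα'; exact_mod_cast hα'
    have h2 : ((b + a : ℕ) : ℝ) = (Fintype.card V : ℕ) := by push_cast; rw [ha, hb]; ring
    have h3 : b + a = Fintype.card V := by exact_mod_cast h2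
    exact ⟨h1, by omega⟩
  rcases hasTwinType_or_compl hα hα' hV hG with ⟨a, ha, R, s, hR, hGR⟩ | ⟨a, ha, R, s, hR, hGR⟩ <;>
  rcases hasTwinType_or_compl hα hα' hV hH with ⟨b, hb, S, t, hS, hHS⟩ | ⟨b, hb, S, t, hS, hHS⟩
  · obtain rfl : a = b := by
      have := ha.trans hb.symm
      exact_mod_cast this
    rw [hσ] at hS
    exact hR.nonempty_iso hV hS hGR hHS
  · obtain ⟨h1, h2⟩ := hlt ha hb
    rw [sum_degree_compl_sub a b h2 h1.le, hσ] at hS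
    rw [h2] at hS
    exact hR.nonempty_iso_of_compl hV h1 hS hGR hHS
  · obtain ⟨h1, h2⟩ := hlt hb ha
    rw [sum_degree_compl_sub b a h2 h1.le] at hR
    rw [h2] at hR
    rw [hσ] at hS
    obtain ⟨e⟩ := hS.nonempty_iso_of_compl hV h1 hR hHS hGR
    exact ⟨e.symm⟩
  · obtain rfl : a = b := by
      have := ha.trans hb.symm
      exact_mod_cast this
    refine nonempty_iso_of_compl (hR.nonempty_iso hV ?_ hGR hHS)
    have h1 : a ≤ Fintype.card V := by
      have : (a : ℝ) ≤ Fintype.card V := by rw [ha]; linarith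
      exact_mod_cast this
    have h2 : a = Fintype.card V - (Fintype.card V - a) := by omega
    rw [sum_degree_compl_sub _ a h2 (Nat.sub_le _ _), hσ] at hS
    rwa [sum_degree_compl_sub _ a h2 (Nat.sub_le _ _)]

end SimpleGraph

namespace SimpleGraph

section Code

variable {n m : ℕ}

/-- The index of the pair `{i, j}` in the colexicographic order. -/
def pairIndex (i j : Fin n) : ℕ := (max i j).val * ((max i j).val - 1) / 2 + (min i j).val

lemma pairIndex_comm (i j : Fin n) : pairIndex i j = pairIndex j i := by
  rw [pairIndex, pairIndex, max_comm, min_comm]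

/-- The graph whose edges are the positions of the nonzero binary digits of `c`. -/
def ofCode (n c : ℕ) : SimpleGraph (Fin n) where
  Adj i j := i ≠ j ∧ c.testBit (pairIndex i j) = true
  symm := ⟨fun i j h => ⟨h.1.symm, by rw [pairIndex_comm]; exact h.2⟩⟩
  loopless := ⟨fun _ h => h.1 rfl⟩

instance (c : ℕ) : DecidableRel (ofCode n c).Adj := fun i j =>
  inferInstanceAs (Decidable (i ≠ j ∧ c.testBit (pairIndex i j) = true))

/-- The number whose binary digits are the adjacencies in `G` of the pairs listed by `e`. -/
def code (e : Fin m → Fin n × Fin n) (G : SimpleGraph (Fin n)) [DecidableRel G.Adj] : ℕ :=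
  Nat.ofBits fun k => decide (G.Adj (e k).1 (e k).2)

variable {e : Fin m → Fin n × Fin n}

lemma ofCode_code (he : ∀ i j : Fin n, i ≠ j → ∃ k : Fin m, k = pairIndex i j ∧
    (e k = (i, j) ∨ e k = (j, i))) (G : SimpleGraph (Fin n)) [DecidableRel G.Adj] :
    ofCode n (code e G) = G := by
  ext i j
  change i ≠ j ∧ (code e G).testBit (pairIndex i j) = true ↔ _
  by_cases hij : i = j
  · simp [hij]
  obtain ⟨k, hk, h⟩ := he i j hij
  rw [← hk, code, Nat.testBit_ofBits_lt _ _ k.2]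
  rcases h with h | h <;> simp [h, hij, G.adj_comm]


/-- The number whose binary digits are the digits of `c` at the positions `l`. -/
def gather (c : ℕ) : List ℕ → ℕ
  | [] => 0
  | p :: l => 2 * gather c l + c / 2 ^ p % 2

lemma ofBits_testBit_eq_gather (c : ℕ) : ∀ {m : ℕ} (p : Fin m → ℕ),
    Nat.ofBits (fun k => c.testBit (p k)) = gather c (List.ofFn p)
  | 0, _ => by simp [gather]
  | m + 1, p => by
    rw [Nat.ofBits_succ, List.ofFn_succ, gather, ← ofBits_testBit_eq_gather c, Nat.toNat_testBit]
    rfl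

/-- The positions, in the code of `G`, of the digits of the code of `G.comap f`. -/
def positions (e : Fin m → Fin n × Fin n) (f : Fin n → Fin n) : List ℕ :=
  List.ofFn fun k => pairIndex (f (e k).1) (f (e k).2)

lemma code_comap (he : ∀ k, (e k).1 ≠ (e k).2) (c : ℕ) {f : Fin n → Fin n}
    (hf : f.Injective) : code e ((ofCode n c).comap f) = gather c (positions e f) := by
  rw [positions, ← ofBits_testBit_eq_gather, code]
  congr 1
  funext k
  have h : ((ofCode n c).comap f).Adj (e k).1 (e k).2 ↔
      c.testBit (pairIndex (f (e k).1) (f (e k).2)) = true :=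
    and_iff_right (hf.ne (he k))
  rw [Bool.eq_iff_iff, decide_eq_true_iff, h]

/-- A graph is isomorphic to one whose code is not made smaller by the relabellings `P`. -/
lemma exists_iso_ofCode (he : ∀ k, (e k).1 ≠ (e k).2)
    (he' : ∀ i j : Fin n, i ≠ j → ∃ k : Fin m, k = pairIndex i j ∧ (e k = (i, j) ∨ e k = (j, i)))
    {P : List (Fin n → Fin n)} (hP : ∀ l ∈ P.map List.ofFn, l.Nodup) {L : List (List ℕ)}
    (hL : P.map (positions e) = L) {reps : List ℕ}
    (hreps : ((List.range (2 ^ m)).filter fun c => ∀ l ∈ L, c ≤ gather c l) = reps)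
    (G : SimpleGraph (Fin n)) : ∃ c ∈ reps, Nonempty (ofCode n c ≃g G) := by
  classical
  have hex : ∃ c, c < 2 ^ m ∧ Nonempty (ofCode n c ≃g G) :=
    ⟨code e G, Nat.ofBits_lt_two_pow _, by rw [ofCode_code he']; exact ⟨Iso.refl⟩⟩
  obtain ⟨hlt, ⟨φ⟩⟩ := Nat.find_spec hex
  refine ⟨Nat.find hex, ?_, ⟨φ⟩⟩
  subst hreps
  simp only [List.mem_filter, List.mem_range, decide_eq_true_eq]
  refine ⟨hlt, fun l hl => ?_⟩
  rw [← hL, List.mem_map] at hl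
  obtain ⟨f, hf, rfl⟩ := hl
  rw [← code_comap he _ (List.nodup_ofFn.1 (hP _ (List.mem_map_of_mem hf)))]
  refine Nat.find_min' hex ⟨Nat.ofBits_lt_two_pow _, ?_⟩
  rw [ofCode_code he']
  have hbij : f.Bijective := Finite.injective_iff_bijective.1
    (List.nodup_ofFn.1 (hP _ (List.mem_map_of_mem hf)))
  exact ⟨φ.comp (Iso.comap (Equiv.ofBijective f hbij) _)⟩

end Code

section Trace

variable {V W : Type*} [Fintype V] [DecidableEq V] [Fintype W] [DecidableEq W]

/-- The traces of the first three powers of the Laplacian matrix. -/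
def lapTraces (G : SimpleGraph V) [DecidableRel G.Adj] : List ℤ :=
  [(G.lapMatrix ℤ).trace, (G.lapMatrix ℤ ^ 2).trace, (G.lapMatrix ℤ ^ 3).trace]

lemma Iso.lapMatrix_submatrix {G : SimpleGraph V} {H : SimpleGraph W} [DecidableRel G.Adj]
    [DecidableRel H.Adj] (φ : G ≃g H) (R : Type*) [AddGroupWithOne R] :
    (H.lapMatrix R).submatrix φ φ = G.lapMatrix R := by
  ext i j
  by_cases hij : i = j
  · subst hij
    simp [lapMatrix, degMatrix, φ.degree_eq]
  · simp [lapMatrix, degMatrix, hij, φ.map_adj_iff, adjMatrix_apply]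

lemma Iso.lapTraces_eq {G : SimpleGraph V} {H : SimpleGraph W} [DecidableRel G.Adj]
    [DecidableRel H.Adj] (φ : G ≃g H) : lapTraces G = lapTraces H := by
  have h : ∀ k, (G.lapMatrix ℤ ^ k).trace = (H.lapMatrix ℤ ^ k).trace := by
    intro k
    have h1 : G.lapMatrix ℤ = Matrix.reindexAlgEquiv ℤ ℤ φ.symm.toEquiv (H.lapMatrix ℤ) :=
      (φ.lapMatrix_submatrix ℤ).symm
    rw [h1, ← map_pow]
    exact Equiv.sum_comp φ.toEquiv fun i => (H.lapMatrix ℤ ^ k) i i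
  have h1 := h 1
  rw [pow_one, pow_one] at h1
  rw [lapTraces, lapTraces, h1, h, h]

lemma trace_lapMatrix_pow_cast (G : SimpleGraph V) [DecidableRel G.Adj] (k : ℕ) :
    (G.lapMatrix ℝ ^ k).trace = ((G.lapMatrix ℤ ^ k).trace : ℤ) := by
  have h : G.lapMatrix ℝ = (Int.castRingHom ℝ).mapMatrix (G.lapMatrix ℤ) := by
    ext i j
    by_cases hij : i = j
    · subst hij
      simp [lapMatrix, degMatrix]
    · simp [lapMatrix, degMatrix, hij, adjMatrix_apply]
  rw [h, ← map_pow]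
  simp [Matrix.trace]

lemma lapTraces_eq_of_trace_pow_eq {G H : SimpleGraph V} [DecidableRel G.Adj] [DecidableRel H.Adj]
    (h : ∀ k, (G.lapMatrix ℝ ^ k).trace = (H.lapMatrix ℝ ^ k).trace) :
    lapTraces G = lapTraces H := by
  have h' : ∀ k, (G.lapMatrix ℤ ^ k).trace = (H.lapMatrix ℤ ^ k).trace := by
    intro k
    have := h k
    rw [trace_lapMatrix_pow_cast, trace_lapMatrix_pow_cast] at this
    exact_mod_cast this
  have h1 := h' 1
  rw [pow_one, pow_one] at h1
  rw [lapTraces, lapTraces, h1, h', h']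

end Trace

lemma nonempty_iso_of_lapTraces_eq {n : ℕ} {reps : List ℕ}
    (hex : ∀ G : SimpleGraph (Fin n), ∃ c ∈ reps, Nonempty (ofCode n c ≃g G))
    (hnd : (reps.map fun c => lapTraces (ofCode n c)).Nodup) {G H : SimpleGraph (Fin n)}
    [DecidableRel G.Adj] [DecidableRel H.Adj] (h : lapTraces G = lapTraces H) :
    Nonempty (G ≃g H) := by
  obtain ⟨c, hc, ⟨φ⟩⟩ := hex G
  obtain ⟨d, hd, ⟨ψ⟩⟩ := hex H
  obtain rfl : c = d := List.inj_on_of_nodup_map hnd hc hd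
    (φ.lapTraces_eq.trans (h.trans ψ.lapTraces_eq.symm))
  exact ⟨ψ.comp φ.symm⟩

lemma nonempty_iso_of_lapTraces_eq_four {G H : SimpleGraph (Fin 4)} [DecidableRel G.Adj]
    [DecidableRel H.Adj] (h : lapTraces G = lapTraces H) : Nonempty (G ≃g H) := by
  refine nonempty_iso_of_lapTraces_eq (fun G => ?_) ?_ h
    (reps := [0, 1, 3, 7, 11, 12, 13, 15, 30, 31, 63])
  · refine exists_iso_ofCode (L := [[1, 3, 5, 0, 2, 4], [0, 2, 1, 4, 3, 5], [0, 3, 4, 1, 2, 5],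
        [1, 0, 2, 3, 5, 4]])
      (P := [![0, 2, 3, 1], ![1, 0, 2, 3], ![0, 1, 3, 2], ![0, 2, 1, 3]])
      (e := ![(0, 1), (0, 2), (1, 2), (0, 3), (1, 3), (2, 3)]) ?_ ?_ ?_ ?_ ?_ G
    all_goals decide +kernel
  · decide +kernel

lemma nonempty_iso_of_lapTraces_eq_five {G H : SimpleGraph (Fin 5)} [DecidableRel G.Adj]
    [DecidableRel H.Adj] (h : lapTraces G = lapTraces H) : Nonempty (G ≃g H) := by
  refine nonempty_iso_of_lapTraces_eq (fun G => ?_) ?_ h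
    (reps := [0, 1, 3, 7, 11, 12, 13, 15, 30, 31, 63, 75, 76, 77, 79, 86, 87, 94, 95, 116, 117,
      119, 127, 222, 223, 235, 236, 237, 239, 254, 255, 507, 511, 1023])
  · refine exists_iso_ofCode (L := [[2, 4, 5, 7, 8, 9, 0, 1, 3, 6],
        [1, 3, 5, 0, 2, 4, 6, 8, 9, 7], [1, 0, 2, 6, 8, 7, 3, 5, 4, 9],
        [0, 4, 3, 2, 1, 5, 7, 6, 9, 8], [0, 3, 4, 1, 2, 5, 6, 7, 9, 8],
        [0, 2, 1, 4, 3, 5, 7, 6, 8, 9], [7, 4, 9, 0, 6, 3, 2, 8, 5, 1],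
        [1, 0, 2, 3, 5, 4, 6, 8, 7, 9], [0, 2, 1, 7, 6, 8, 4, 3, 5, 9]])
      (P := [![1, 2, 3, 4, 0], ![0, 2, 3, 1, 4], ![0, 2, 1, 4, 3], ![1, 0, 3, 2, 4],
        ![0, 1, 3, 2, 4], ![1, 0, 2, 3, 4], ![1, 4, 3, 0, 2], ![0, 2, 1, 3, 4], ![1, 0, 2, 4, 3]])
      (e := ![(0, 1), (0, 2), (1, 2), (0, 3), (1, 3), (2, 3), (0, 4), (1, 4), (2, 4), (3, 4)])
      ?_ ?_ ?_ ?_ ?_ G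
    all_goals decide +kernel
  · decide +kernel

end SimpleGraph

namespace SimpleGraph

section RankTwo

variable {V : Type*} [Fintype V] {K K' : SimpleGraph V} [DecidableRel K.Adj]
  [DecidableRel K'.Adj]

lemma sum_adj_le_degree (S : Finset V) (x : V) :
    ∑ w ∈ S, (if K.Adj x w then 1 else 0) ≤ K.degree x := by
  rw [← Finset.card_filter]
  refine Finset.card_le_card fun w hw => ?_
  rw [mem_neighborFinset]
  exact (Finset.mem_filter.1 hw).2

lemma degree_eq_sum_adj {S : Finset V} (hS : ∀ x y, K.Adj x y → y ∈ S) (x : V) :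
    K.degree x = ∑ w ∈ S, (if K.Adj x w then 1 else 0) := by
  rw [← Finset.card_filter]
  change Finset.card _ = _
  congr 1
  ext w
  rw [mem_neighborFinset, Finset.mem_filter]
  exact ⟨fun h => ⟨hS _ _ h, h⟩, fun h => h.2⟩

lemma sum_degree_pow {S : Finset V} (hS : ∀ x y, K.Adj x y → y ∈ S) {k : ℕ} (hk : k ≠ 0) :
    ∑ x, (K.degree x : ℤ) ^ k = ∑ x ∈ S, (K.degree x : ℤ) ^ k := by
  refine (Finset.sum_subset (Finset.subset_univ S) fun x _ hx => ?_).symm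
  have h0 : K.degree x = 0 := by
    rw [degree_eq_zero_iff_notMem_support, mem_support]
    rintro ⟨w, hw⟩
    exact hx (hS w x hw.symm)
  rw [h0, Nat.cast_zero, zero_pow hk]

variable [DecidableEq V]

/-- If the Laplacian matrix has rank at most `2` and `x`, `y` have neighbours outside of
`{x, y, z}`, then `z` is isolated. -/
lemma not_adj_of_rank_lapMatrix_le_two (h : (K.lapMatrix ℝ).rank ≤ 2) {x y z x' y' : V}
    (hxy : x ≠ y) (hxz : x ≠ z) (hyz : y ≠ z) (hx : K.Adj x x') (hxy' : x' ≠ y) (hxz' : x' ≠ z)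
    (hy : K.Adj y y') (hyx' : y' ≠ x) (hyz' : y' ≠ z) (z' : V) : ¬ K.Adj z z' := by
  intro hz
  have h1 := Matrix.det_three_eq_zero h x y z x y z
  have hd : ∀ u, K.lapMatrix ℝ u u = K.degree u := by simp [lapMatrix, degMatrix]
  have ho : ∀ {u w}, u ≠ w → K.lapMatrix ℝ u w = - if K.Adj u w then 1 else 0 := by
    intro u w huw
    simp [lapMatrix, degMatrix, huw]
  have c1 := K.adj_comm y x
  have c2 := K.adj_comm z x
  have c3 := K.adj_comm z y
  rw [hd, hd, hd, ho hxy, ho hxz, ho hyz, ho hxy.symm, ho hxz.symm, ho hyz.symm] at h1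
  have dx := sum_adj_le_degree (K := K) {x', y, z} x
  have dy := sum_adj_le_degree (K := K) {y', x, z} y
  have dz := sum_adj_le_degree (K := K) {x, y} z
  have dz' : 1 ≤ K.degree z := by
    rw [Nat.one_le_iff_ne_zero, Ne, degree_eq_zero_iff_notMem_support, mem_support]
    exact fun h => h ⟨z', hz⟩
  rw [Finset.sum_insert (by simp [hxy', hxz']), Finset.sum_pair hyz, if_pos hx] at dx
  rw [Finset.sum_insert (by simp [hyx', hyz']), Finset.sum_pair hxz, if_pos hy] at dy
  rw [Finset.sum_pair hxy] at dz
  generalize K.degree x = a, K.degree y = b, K.degree z = c at *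
  simp only [c1, c2, c3] at h1 dx dy dz
  have key : a * b * c = 2 * (if K.Adj x y then 1 else 0) * (if K.Adj x z then 1 else 0) *
      (if K.Adj y z then 1 else 0) + a * (if K.Adj y z then 1 else 0) +
      b * (if K.Adj x z then 1 else 0) + c * (if K.Adj x y then 1 else 0) := by
    rw [← Nat.cast_inj (R := ℝ)]
    push_cast
    split_ifs at h1 ⊢ <;> linarith
  obtain ⟨a, rfl⟩ := Nat.exists_eq_add_of_le dx
  obtain ⟨b, rfl⟩ := Nat.exists_eq_add_of_le dy
  by_cases p : K.Adj x y <;> by_cases q : K.Adj x z <;> by_cases r : K.Adj y z <;>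
    simp only [p, q, r, if_true, if_false] at key dz <;>
    nlinarith [Nat.zero_le (a * b * c), Nat.zero_le (a * c), Nat.zero_le (b * c),
      Nat.mul_le_mul_left a dz, Nat.mul_le_mul_left b dz, Nat.mul_le_mul_left (a * b) dz]

/-- The complements of the graphs on `n` vertices with Laplacian eigenvalue `n` of multiplicity
`n - 3`; `s` and `t` are the sums of the degrees and of their squares. -/
inductive RankTwoType (n : ℕ) (s t : ℤ) : (Fin 4 → Fin 4 → Bool) → (Fin 4 → ℕ) → Prop
  | path (b : Bool) (hs : s = if b then 6 else 4) (ht : t = if b then 12 else 6) :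
      RankTwoType n s t
        (looped false true false false b false false false false false) ![1, 2, n - 3, 0]
  | matching (k : ℕ) (hs : s = 2 + k) (ht : t = 2 + k) :
      RankTwoType n s t
        (looped true false false false true false false false false false) ![2, k, n - 2 - k, 0]

lemma RankTwoType.eq_and_eq {n : ℕ} {s t : ℤ} {R R' : Fin 4 → Fin 4 → Bool} {c c' : Fin 4 → ℕ}
    (h : RankTwoType n s t R c) (h' : RankTwoType n s t R' c') : R = R' ∧ c = c' := by
  cases h with
  | path b => cases h' with
    | path b' => cases b <;> cases b' <;> first | exact ⟨rfl, rfl⟩ | (simp at *; omega)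
    | matching k => cases b <;> simp at * <;> omega
  | matching k => cases h' with
    | path b => cases b <;> simp at * <;> omega
    | matching k' =>
      obtain rfl : k = k' := by omega
      exact ⟨rfl, rfl⟩

lemma exists_rankTwoType_of_path (h : (K.lapMatrix ℝ).rank ≤ 2) {u v w : V} (huw : u ≠ w)
    (hu : K.Adj v u) (hw : K.Adj v w) :
    ∃ R c, RankTwoType (Fintype.card V) (∑ x, (K.degree x : ℤ)) (∑ x, (K.degree x : ℤ) ^ 2) R c ∧
      K.IsBlowup R c := by
  have hS : ∀ x y, K.Adj x y → y ∈ ({v, u, w} : Finset V) := by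
    intro x y hxy
    by_contra hy
    simp only [Finset.mem_insert, Finset.mem_singleton, not_or] at hy
    exact not_adj_of_rank_lapMatrix_le_two h huw (Ne.symm hy.2.1) (Ne.symm hy.2.2) hu.symm hw.ne
      (Ne.symm hy.1) hw.symm hu.ne (Ne.symm hy.1) x hxy.symm
  have hsum : ∀ f : V → ℤ, ∑ x ∈ ({v, u, w} : Finset V), f x = f v + f u + f w := by
    intro f
    rw [Finset.sum_insert (by simp [hu.ne, hw.ne]), Finset.sum_pair huw, add_assoc]
  have hdeg : ∀ x, (K.degree x : ℤ) = (if K.Adj x v then 1 else 0) + (if K.Adj x u then 1 else 0) +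
      if K.Adj x w then 1 else 0 := by
    intro x
    rw [degree_eq_sum_adj hS]
    push_cast
    exact hsum fun y => if K.Adj x y then 1 else 0
  have h1 := sum_degree_pow hS one_ne_zero
  have h2 := sum_degree_pow hS two_ne_zero
  simp only [pow_one] at h1
  rw [hsum, hdeg v, hdeg u, hdeg w] at h1 h2
  simp only [hu, hw, hu.symm, hw.symm, K.irrefl, K.adj_comm w u, if_true, if_false] at h1 h2
  refine ⟨_, _, RankTwoType.path (decide (K.Adj u w)) ?_ ?_,
    isBlowup_looped_three (S0 := {v}) (S1 := {u, w}) (S2 := Finset.univ \ {v, u, w})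
      ?_ ?_ ?_ ?_ ?_ ?_ ?_ ?_ ?_ ?_ ?_ ?_ ?_⟩
  · rw [h1]
    split_ifs <;> simp_all
  · rw [h2]
    split_ifs <;> simp_all
  · simp
  · rw [Finset.card_pair huw]
  · rw [Finset.card_sdiff_of_subset (Finset.subset_univ _), Finset.card_univ,
      Finset.card_insert_of_notMem (by simp [hu.ne, hw.ne]), Finset.card_pair huw]
  · intro x
    simp
    tauto
  · simp [hu.ne, hw.ne]
  · simp
  · simp
  · simp
  · simp [hu, hw]
  · intro x _ y hy _
    simp only [Finset.mem_sdiff, Finset.mem_univ, true_and] at hy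
    simpa using fun hxy => hy (hS _ _ hxy)
  · simp [huw, huw.symm, K.adj_comm w u]
  · intro x _ y hy _
    simp only [Finset.mem_sdiff, Finset.mem_univ, true_and] at hy
    simpa using fun hxy => hy (hS _ _ hxy)
  · intro x _ y hy _
    simp only [Finset.mem_sdiff, Finset.mem_univ, true_and] at hy
    simpa using fun hxy => hy (hS _ _ hxy)

lemma exists_rankTwoType (h : (K.lapMatrix ℝ).rank = 2) :
    ∃ R c, RankTwoType (Fintype.card V) (∑ x, (K.degree x : ℤ)) (∑ x, (K.degree x : ℤ) ^ 2) R c ∧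
      K.IsBlowup R c := by
  by_cases hpath : ∃ v u w, u ≠ w ∧ K.Adj v u ∧ K.Adj v w
  · obtain ⟨v, u, w, huw, hu, hw⟩ := hpath
    exact exists_rankTwoType_of_path h.le huw hu hw
  have huniq : ∀ {v u w}, K.Adj v u → K.Adj v w → u = w := by
    intro v u w hu hw
    by_contra huw
    exact hpath ⟨v, u, w, huw, hu, hw⟩
  obtain ⟨u, v, huv⟩ : ∃ u v, K.Adj u v := by
    by_contra! h0
    have : K.lapMatrix ℝ = 0 := by
      have h1 : ∀ x, K.degree x = 0 := by
        intro x
        rw [degree_eq_zero_iff_notMem_support, mem_support]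
        exact fun ⟨w, hw⟩ => h0 x w hw
      ext x y
      by_cases hxy : x = y
      · subst hxy
        simp [lapMatrix, degMatrix, h1]
      · simp [lapMatrix, degMatrix, hxy, h0 x y]
    rw [this, Matrix.rank_zero] at h
    omega
  obtain ⟨S, hS, hSd, hSc⟩ : ∃ S : Finset V, (∀ x y, K.Adj x y → y = u ∨ y = v ∨ y ∈ S) ∧
      (∀ x ∈ S, x ≠ u ∧ x ≠ v ∧ ∃ y ∈ S, K.Adj x y) ∧
      ∀ x ∈ S, ∀ y ∈ S, x ≠ y → K.Adj x y := by
    by_cases hwz : ∃ w z, w ≠ u ∧ w ≠ v ∧ K.Adj w z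
    · obtain ⟨w, z, hwu, hwv, hwz⟩ := hwz
      have hzu : z ≠ u := by
        rintro rfl
        exact hwv (huniq hwz.symm huv)
      have hzv : z ≠ v := by
        rintro rfl
        exact hwu (huniq hwz.symm huv.symm)
      refine ⟨{w, z}, fun x y hxy => ?_, ?_, ?_⟩
      · by_contra hy
        simp only [Finset.mem_insert, Finset.mem_singleton, not_or] at hy
        exact not_adj_of_rank_lapMatrix_le_two h.le hwu.symm (Ne.symm hy.1) (Ne.symm hy.2.2.1)
          huv hwv.symm (Ne.symm hy.2.1) hwz hzu (Ne.symm hy.2.2.2) x hxy.symm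
      · simp [hwu, hwv, hzu, hzv, hwz, hwz.symm]
      · simp [hwz, hwz.symm]
    · push Not at hwz
      refine ⟨∅, fun x y hxy => ?_, by simp, by simp⟩
      have := hwz y x
      by_contra! hy
      exact this hy.1 hy.2.1 hxy.symm
  have huS : u ∉ S := fun h => (hSd u h).1 rfl
  have hvS : v ∉ S := fun h => (hSd v h).2.1 rfl
  have hT : ∀ x y, K.Adj x y → y ∈ insert u (insert v S) := by
    intro x y hxy
    simpa using hS x y hxy
  have hdeg : ∀ x ∈ insert u (insert v S), K.degree x = 1 := by
    intro x hx
    rw [degree_eq_one_iff_existsUnique_adj]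
    have : ∃ y, K.Adj x y := by
      simp only [Finset.mem_insert] at hx
      rcases hx with rfl | rfl | hx
      · exact ⟨v, huv⟩
      · exact ⟨u, huv.symm⟩
      · obtain ⟨y, -, hy⟩ := (hSd x hx).2.2
        exact ⟨y, hy⟩
    obtain ⟨y, hy⟩ := this
    exact ⟨y, hy, fun z hz => huniq hz hy⟩
  have hcard : (insert u (insert v S)).card = 2 + S.card := by
    rw [Finset.card_insert_of_notMem (by simp [huv.ne, huS]), Finset.card_insert_of_notMem hvS]
    omega
  have hsum : ∀ k : ℕ, k ≠ 0 → ∑ x, (K.degree x : ℤ) ^ k = 2 + S.card := by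
    intro k hk
    rw [sum_degree_pow hT hk, Finset.sum_congr rfl fun x hx => by rw [hdeg x hx]]
    simp [hcard]
  have h1 := hsum 1 one_ne_zero
  simp only [pow_one] at h1
  refine ⟨_, _, RankTwoType.matching S.card h1 (hsum 2 two_ne_zero),
    isBlowup_looped_three (S0 := {u, v}) (S1 := S) (S2 := Finset.univ \ insert u (insert v S))
      ?_ rfl ?_ ?_ ?_ ?_ ?_ ?_ ?_ ?_ ?_ ?_ ?_⟩
  · rw [Finset.card_pair huv.ne]
  · rw [Finset.card_sdiff_of_subset (Finset.subset_univ _), Finset.card_univ, hcard]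
    omega
  · intro x
    simp
    tauto
  · simp [huS, hvS]
  · simp
  · intro x hx
    simp [hx]
  · simp [huv, huv.symm]
  · intro x hx y hy _
    obtain ⟨hyu, hyv, -⟩ := hSd y hy
    simp only [Finset.mem_insert, Finset.mem_singleton] at hx
    rcases hx with rfl | rfl
    · simpa using fun hxy => hyv (huniq hxy huv)
    · simpa using fun hxy => hyu (huniq hxy huv.symm)
  · intro x _ y hy _
    simp only [Finset.mem_sdiff, Finset.mem_univ, true_and] at hy
    simpa using fun hxy => hy (hT _ _ hxy)
  · intro x hx y hy hxy
    simpa using hSc x hx y hy hxy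
  · intro x _ y hy _
    simp only [Finset.mem_sdiff, Finset.mem_univ, true_and] at hy
    simpa using fun hxy => hy (hT _ _ hxy)
  · intro x _ y hy _
    simp only [Finset.mem_sdiff, Finset.mem_univ, true_and] at hy
    simpa using fun hxy => hy (hT _ _ hxy)

lemma nonempty_iso_of_rank_lapMatrix_eq_two (h : (K.lapMatrix ℝ).rank = 2)
    (h' : (K'.lapMatrix ℝ).rank = 2) (h1 : ∑ x, (K.degree x : ℤ) = ∑ x, (K'.degree x : ℤ))
    (h2 : ∑ x, (K.degree x : ℤ) ^ 2 = ∑ x, (K'.degree x : ℤ) ^ 2) : Nonempty (K ≃g K') := by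
  obtain ⟨R, c, hR, hK⟩ := exists_rankTwoType h
  obtain ⟨R', c', hR', hK'⟩ := exists_rankTwoType h'
  rw [h1, h2] at hR
  obtain ⟨rfl, rfl⟩ := hR.eq_and_eq hR'
  exact hK.nonempty_iso hK' (Equiv.refl _) (fun _ => rfl) (fun _ _ _ _ => rfl)

variable {G H : SimpleGraph V} [DecidableRel G.Adj] [DecidableRel H.Adj]

lemma rank_lapMatrix_compl [Nonempty V]
    (h : (G.lapMatrix ℝ - (Fintype.card V : ℝ) • (1 : Matrix V V ℝ)).rank = 3) :
    (Gᶜ.lapMatrix ℝ).rank = 2 := by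
  have h0 : (Fintype.card V : ℝ) ≠ 0 := by exact_mod_cast Fintype.card_ne_zero
  have h1 := G.shiftedLap_compl (Fintype.card V)
  rw [sub_self] at h1
  have h2 : Gᶜ.shiftedLap 0 = Gᶜ.lapMatrix ℝ := by
    ext i j
    simp [shiftedLap, Matrix.vecMulVec_apply]
  rw [← h2, h1, Matrix.rank_neg, G.rank_shiftedLap _ h0 h]

lemma nonempty_iso_of_eq_card [Nonempty V]
    (hG : (G.lapMatrix ℝ - (Fintype.card V : ℝ) • (1 : Matrix V V ℝ)).rank = 3)
    (hH : (H.lapMatrix ℝ - (Fintype.card V : ℝ) • (1 : Matrix V V ℝ)).rank = 3)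
    (h1 : ∑ u, (G.degree u : ℤ) = ∑ u, (H.degree u : ℤ))
    (h2 : ∑ u, (G.degree u : ℤ) ^ 2 = ∑ u, (H.degree u : ℤ) ^ 2) : Nonempty (G ≃g H) := by
  have hc : ∀ (K : SimpleGraph V) [DecidableRel K.Adj] (u : V),
      (Kᶜ.degree u : ℤ) = (Fintype.card V - 1) - K.degree u := by
    intro K _ u
    have := K.degree_lt_card_verts u
    rw [degree_compl]
    omega
  refine nonempty_iso_of_compl (nonempty_iso_of_rank_lapMatrix_eq_two (rank_lapMatrix_compl hG)
    (rank_lapMatrix_compl hH) ?_ ?_)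
  · simp only [hc, Finset.sum_sub_distrib, h1]
  · simp only [hc, sub_sq, Finset.sum_add_distrib, Finset.sum_sub_distrib, ← Finset.mul_sum, h1, h2]

end RankTwo

lemma trace_lapMatrix {V : Type*} [Fintype V] [DecidableEq V] (G : SimpleGraph V)
    [DecidableRel G.Adj] : (G.lapMatrix ℝ).trace = (∑ u, (G.degree u : ℤ) : ℤ) := by
  simp [Matrix.trace, lapMatrix, degMatrix]

lemma trace_lapMatrix_sq {V : Type*} [Fintype V] [DecidableEq V] (G : SimpleGraph V)
    [DecidableRel G.Adj] : (G.lapMatrix ℝ ^ 2).trace =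
      (∑ u, (G.degree u : ℤ) ^ 2 + ∑ u, (G.degree u : ℤ) : ℤ) := by
  have h : G.lapMatrix ℝ ^ 2 = G.degMatrix ℝ ^ 2 - G.degMatrix ℝ * G.adjMatrix ℝ -
      G.adjMatrix ℝ * G.degMatrix ℝ + G.adjMatrix ℝ * G.adjMatrix ℝ := by
    rw [lapMatrix]
    noncomm_ring
  have h1 : (G.degMatrix ℝ * G.adjMatrix ℝ).trace = 0 := by
    simp only [Matrix.trace, Matrix.diag, degMatrix, Matrix.diagonal_mul]
    simp
  have h2 : (G.adjMatrix ℝ * G.adjMatrix ℝ).trace = ∑ u, (G.degree u : ℝ) := by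
    simp only [Matrix.trace, Matrix.diag, adjMatrix_mul_self_apply_self]
  rw [h, Matrix.trace_add, Matrix.trace_sub, Matrix.trace_sub,
    Matrix.trace_mul_comm (G.adjMatrix ℝ), h1, h2]
  simp [degMatrix, Matrix.diagonal_pow, Matrix.trace]

end SimpleGraph

/-- Let `n ≥ 4` and let `G` be a connected simple graph on `n` vertices having
a Laplacian eigenvalue of multiplicity `n − 3`. If `H` is any simple graph on `n` vertices
whose Laplacian spectrum (as a multiset, with multiplicities) equals that of `G`, then `H`
is isomorphic to `G`: every graph in `𝒢(n, n−3)` is determined by its Laplacian spectrum. -/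
theorem determined_by_laplacian_spectrum
    (n : ℕ) (hn : 4 ≤ n)
    (G : SimpleGraph (Fin n)) [DecidableRel G.Adj] (hconn : G.Connected)
    (hmult : ∃ α : ℝ, ((G.lapMatrix ℝ).charpoly.rootMultiplicity α) = n - 3)
    (H : SimpleGraph (Fin n)) [DecidableRel H.Adj]
    (hspec : (H.lapMatrix ℝ).charpoly.roots = (G.lapMatrix ℝ).charpoly.roots) :
    Nonempty (H ≃g G) := by
  have hLG : (G.lapMatrix ℝ).IsHermitian := (G.posSemidef_lapMatrix ℝ).1
  have hLH : (H.lapMatrix ℝ).IsHermitian := (H.posSemidef_lapMatrix ℝ).1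
  have htr := hLH.trace_pow_eq_of_roots_charpoly_eq hLG hspec
  rcases (by omega : n = 4 ∨ n = 5 ∨ 6 ≤ n) with rfl | rfl | hn6
  · exact SimpleGraph.nonempty_iso_of_lapTraces_eq_four
      (SimpleGraph.lapTraces_eq_of_trace_pow_eq htr)
  · exact SimpleGraph.nonempty_iso_of_lapTraces_eq_five
      (SimpleGraph.lapTraces_eq_of_trace_pow_eq htr)
  obtain ⟨α, hα⟩ := hmult
  have hcard : Fintype.card (Fin n) = n := Fintype.card_fin n
  have hrG := hLG.rank_sub_smul_one_add_rootMultiplicity α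
  have hrH := hLH.rank_sub_smul_one_add_rootMultiplicity α
  rw [← Polynomial.count_roots, hspec, Polynomial.count_roots] at hrH
  rw [hα, hcard] at hrG hrH
  have hG : (G.lapMatrix ℝ - α • (1 : Matrix (Fin n) (Fin n) ℝ)).rank = 3 := by omega
  have hH : (H.lapMatrix ℝ - α • (1 : Matrix (Fin n) (Fin n) ℝ)).rank = 3 := by omega
  obtain ⟨hpos, hle⟩ := SimpleGraph.pos_and_le_card_of_rank_eq_three G hconn (by omega) hG
  have h1 := htr 1
  have h2 := htr 2
  rw [pow_one, pow_one, SimpleGraph.trace_lapMatrix, SimpleGraph.trace_lapMatrix,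
    Int.cast_inj] at h1
  rw [SimpleGraph.trace_lapMatrix_sq, SimpleGraph.trace_lapMatrix_sq, Int.cast_inj, h1,
    add_left_inj] at h2
  rcases hle.lt_or_eq with hlt | rfl
  · exact SimpleGraph.nonempty_iso_of_lt_card hpos hlt (by omega) hH hG h1
  · have : Nonempty (Fin n) := hconn.nonempty
    exact SimpleGraph.nonempty_iso_of_eq_card hH hG h1 h2
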